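/- arXiv:2409.03047 — 2 statements merged into one kernel-verified Lean document; each statement's English description precedes it below -/
import Mathlib

section
/- Let p ≥ q > 0 and let 𝒮_p, 𝒮_q ⊆ ℝ³ be the corresponding polynomial spiral shells. For every K ≥ p/q there exists a K-quasiconformal homeomorphism F: ℝ³ → ℝ³ with F(𝒮_p) = 𝒮_q; indeed, the radial stretch map F(0) = 0, F(x) = |x|^{q/p − 1} x is (p/q)-quasiconformal and maps 𝒮_p onto 𝒮_q. -/
open Metric Set Filter MeasureTheory Topology
open scoped RealInnerProductSpace

noncomputable section

/-- `d`-dimensional Euclidean space. -/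
abbrev Euc (d : ℕ) : Type := EuclideanSpace ℝ (Fin d)

/-- The number of cubes in the axes-oriented `r`-mesh of `ℝ^d` that intersect `E`;
for nonempty bounded `E` this is the box-counting number `N_r(E)`. -/
def meshCubeCount (d : ℕ) (r : ℝ) (E : Set (Euc d)) : ℕ :=
  Set.ncard {k : Fin d → ℤ | ∃ x ∈ E, ∀ i, (k i : ℝ) * r ≤ x i ∧ x i < ((k i : ℝ) + 1) * r}

/-- The lower box dimension `liminf_{r → 0⁺} log N_r(E) / (- log r)`. -/
def lowerBoxDim (d : ℕ) (E : Set (Euc d)) : ℝ :=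
  liminf (fun r : ℝ => Real.log (meshCubeCount d r E : ℝ) / -Real.log r) (𝓝[>] (0 : ℝ))

/-- The upper box dimension `limsup_{r → 0⁺} log N_r(E) / (- log r)`. -/
def upperBoxDim (d : ℕ) (E : Set (Euc d)) : ℝ :=
  limsup (fun r : ℝ => Real.log (meshCubeCount d r E : ℝ) / -Real.log r) (𝓝[>] (0 : ℝ))

/-- The box dimension of `E` exists and equals `v`. -/
def HasBoxDim (d : ℕ) (E : Set (Euc d)) (v : ℝ) : Prop :=
  lowerBoxDim d E = v ∧ upperBoxDim d E = v

/-- The `θ`-Assouad spectrum of `E ⊆ ℝ^d`. -/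
def assouadSpec (d : ℕ) (θ : ℝ) (E : Set (Euc d)) : ℝ :=
  sInf {α : ℝ | 0 < α ∧ ∃ C : ℝ, 0 < C ∧ ∀ r : ℝ, 0 < r → r < 1 → ∀ x ∈ E,
    (meshCubeCount d r (ball x (r ^ θ) ∩ E) : ℝ) ≤ C * (r ^ (θ - 1)) ^ α}

/-- The regularized (upper) `θ`-Assouad spectrum of `E ⊆ ℝ^d`. -/
def regAssouadSpec (d : ℕ) (θ : ℝ) (E : Set (Euc d)) : ℝ :=
  sInf {α : ℝ | 0 < α ∧ ∃ C : ℝ, 0 < C ∧ ∀ r R : ℝ, 0 < r → 0 < R → r ≤ R ^ (1 / θ) → R < 1 →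
    ∀ x ∈ E, (meshCubeCount d r (ball x R ∩ E) : ℝ) ≤ C * (R / r) ^ α}

/-- The Assouad dimension of `E ⊆ ℝ^d`. -/
def assouadDim (d : ℕ) (E : Set (Euc d)) : ℝ :=
  sInf {α : ℝ | 0 < α ∧ ∃ C : ℝ, 0 < C ∧ ∀ r R : ℝ, 0 < r → r ≤ R → ∀ x ∈ E,
    (meshCubeCount d r (ball x R ∩ E) : ℝ) ≤ C * (R / r) ^ α}

/-- The (Euclidean) distance between two sets. -/
def setDistance {d : ℕ} (A B : Set (Euc d)) : ℝ :=
  sInf (Set.image2 dist A B)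

/-- `S ⊆ ℝ^d` is a topological sphere: the image of the unit sphere under a
self-homeomorphism of `ℝ^d`. -/
def IsTopologicalSphere (d : ℕ) (S : Set (Euc d)) : Prop :=
  ∃ f : Euc d ≃ₜ Euc d, S = f '' sphere (0 : Euc d) 1

/-- `g` is a similarity of `ℝ^d` with similarity ratio `c`, i.e. `g x = c • A x + t`
with `c > 0`, `A` orthogonal and `t ∈ ℝ^d`. -/
def IsSimilarityRatio {d : ℕ} (g : Euc d → Euc d) (c : ℝ) : Prop :=
  0 < c ∧ ∃ A : Euc d ≃ₗᵢ[ℝ] Euc d, ∃ t : Euc d, ∀ x, g x = c • A x + t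

/-- `g` is a similarity map of `ℝ^d`. -/
def IsSimilarity {d : ℕ} (g : Euc d → Euc d) : Prop :=
  ∃ c : ℝ, IsSimilarityRatio g c

/-- `S` is a concentric sphere collection centered at `x₀` and generated by the
topological sphere `S₀`. -/
def IsConcentricSphereColl (d : ℕ) (x₀ : Euc d) (S₀ S : Set (Euc d)) : Prop :=
  ∃ f : Euc d ≃ₜ Euc d, S₀ = f '' sphere (0 : Euc d) 1 ∧ x₀ ∈ f '' ball (0 : Euc d) 1 ∧
    ∃ g : ℕ → Euc d → Euc d, g 0 = id ∧ (∀ n, IsSimilarity (g n)) ∧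
      S = (⋃ n : ℕ, g n '' S₀) ∧
      ∃ c₁ c₂ : ℝ, ∃ n₀ : ℕ, ∃ a : ℕ → ℝ,
        c₁ ∈ Ioc (0 : ℝ) 1 ∧ c₂ ∈ Ioc (0 : ℝ) 1 ∧ 1 ≤ n₀ ∧
        StrictAnti a ∧ Tendsto a atTop (𝓝 (0 : ℝ)) ∧
        ∀ n : ℕ, n₀ ≤ n →
          hausdorffDist (g n '' S₀) {x₀} = c₁ * a n ∧
          setDistance (g n '' S₀) (g (n + 1) '' S₀) = c₂ * (a n - a (n + 1))

/-- `S` is a `p`-polynomially concentric sphere collection centered at `x₀` and generated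
by the topological sphere `S₀` (the defining sequence is `a n = n ^ (-p)`). -/
def IsPConcentricSphereColl (d : ℕ) (p : ℝ) (x₀ : Euc d) (S₀ S : Set (Euc d)) : Prop :=
  ∃ f : Euc d ≃ₜ Euc d, S₀ = f '' sphere (0 : Euc d) 1 ∧ x₀ ∈ f '' ball (0 : Euc d) 1 ∧
    ∃ g : ℕ → Euc d → Euc d, g 0 = id ∧ (∀ n, IsSimilarity (g n)) ∧
      S = (⋃ n : ℕ, g n '' S₀) ∧
      ∃ c₁ c₂ : ℝ, ∃ n₀ : ℕ, ∃ a : ℕ → ℝ,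
        c₁ ∈ Ioc (0 : ℝ) 1 ∧ c₂ ∈ Ioc (0 : ℝ) 1 ∧ 1 ≤ n₀ ∧
        StrictAnti a ∧ Tendsto a atTop (𝓝 (0 : ℝ)) ∧
        (∀ n : ℕ, n₀ ≤ n → a n = (n : ℝ) ^ (-p)) ∧
        ∀ n : ℕ, n₀ ≤ n →
          hausdorffDist (g n '' S₀) {x₀} = c₁ * a n ∧
          setDistance (g n '' S₀) (g (n + 1) '' S₀) = c₂ * (a n - a (n + 1))

/-- The polynomial spiral shell `𝒮_p ⊆ ℝ³`. -/
def spiralShell (p : ℝ) : Set (Euc 3) :=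
  {x : Euc 3 | ∃ u v : ℝ, 1 ≤ u ∧ 1 ≤ v ∧
    x = (WithLp.equiv 2 (Fin 3 → ℝ)).symm
      ![u ^ (-p) * Real.cos u * Real.sin v,
        u ^ (-p) * Real.sin u * Real.sin v,
        u ^ (-p) * Real.cos v]}

/-- The union `⋃_{j ≥ 1} S(0, j^{-p})` of concentric round spheres in `ℝ³`. -/
def sphereUnion (p : ℝ) : Set (Euc 3) :=
  ⋃ j : ℕ, sphere (0 : Euc 3) (((j : ℝ) + 1) ^ (-p))

/-- `F : ℝ³ → ℝ³` is `K`-quasiconformal: `F` lies in the local Sobolev space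
`W^{1,3}_loc(ℝ³; ℝ³)`, witnessed by a weak differential `DF` which is locally `L³`
(integrable on every ball) and satisfies the integration-by-parts identity against every
smooth compactly supported test function, and `|DF|³ ≤ K · det DF` almost everywhere. -/
def IsQuasiconformal (K : ℝ) (F : Euc 3 → Euc 3) : Prop :=
  ∃ DF : Euc 3 → Euc 3 →L[ℝ] Euc 3,
    (∀ R : ℝ, 0 < R → IntegrableOn (fun x => ‖DF x‖ ^ (3 : ℕ)) (ball (0 : Euc 3) R) volume) ∧
    (∀ φ : Euc 3 → ℝ, ContDiff ℝ (⊤ : ℕ∞) φ → HasCompactSupport φ → ∀ v w : Euc 3,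
      ∫ x, fderiv ℝ φ x v * ⟪F x, w⟫ = - ∫ x, φ x * ⟪DF x v, w⟫) ∧
    ∀ᵐ x ∂(volume : Measure (Euc 3)), ‖DF x‖ ^ (3 : ℕ) ≤ K * (DF x).det

section RadialStretch

variable {E : Type*} [NormedAddCommGroup E] [InnerProductSpace ℝ E]

/-- The radial stretch `x ↦ ‖x‖ ^ (s - 1) • x`, regularized at the origin by `ε`. -/
def regStretch (s ε : ℝ) (x : E) : E :=
  (‖x‖ ^ 2 + ε) ^ ((s - 1) / 2) • x

/-- The differential of `regStretch s ε`. -/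
def regStretchDeriv (s ε : ℝ) (x : E) : E →L[ℝ] E :=
  (‖x‖ ^ 2 + ε) ^ ((s - 1) / 2) •
    (ContinuousLinearMap.id ℝ E +
      ((s - 1) / (‖x‖ ^ 2 + ε)) • InnerProductSpace.rankOne ℝ x x)

set_option linter.unusedSectionVars false in
lemma norm_sq_rpow_half (s : ℝ) (x : E) :
    (‖x‖ ^ 2 + 0) ^ ((s - 1) / 2) = ‖x‖ ^ (s - 1) := by
  rw [add_zero, ← Real.rpow_natCast, ← Real.rpow_mul (norm_nonneg x)]
  congr 1
  push_cast
  ring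

lemma regStretch_zero (s : ℝ) (x : E) : regStretch s 0 x = ‖x‖ ^ (s - 1) • x := by
  rw [regStretch, norm_sq_rpow_half]

lemma regStretchDeriv_apply (s ε : ℝ) (x v : E) :
    regStretchDeriv s ε x v = (‖x‖ ^ 2 + ε) ^ ((s - 1) / 2) •
      (v + ((s - 1) / (‖x‖ ^ 2 + ε)) • ⟪x, v⟫ • x) := by
  simp [regStretchDeriv]

lemma hasFDerivAt_regStretch {s ε : ℝ} {x : E} (h : 0 < ‖x‖ ^ 2 + ε) :
    HasFDerivAt (regStretch s ε) (regStretchDeriv s ε x) x := by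
  have h1 : HasFDerivAt (fun y : E => ‖y‖ ^ 2 + ε) (2 • innerSL ℝ x) x :=
    (hasStrictFDerivAt_norm_sq x).hasFDerivAt.add_const ε
  have h2 := (h1.rpow_const (p := (s - 1) / 2) (Or.inl h.ne')).smul (hasFDerivAt_id x)
  refine h2.congr_fderiv ?_
  ext v
  simp only [regStretchDeriv_apply, Real.rpow_sub_one h.ne']
  simp only [add_apply, smul_apply,
    ContinuousLinearMap.smulRight_apply, innerSL_apply_apply, ContinuousLinearMap.id_apply, id,
    smul_add, smul_smul, smul_eq_mul, nsmul_eq_mul]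
  congr 2
  push_cast
  field_simp

lemma rpow_regularization_le {s ε : ℝ} (hs : s ≤ 1) (hε : 0 ≤ ε) {x : E} (hx : x ≠ 0) :
    (‖x‖ ^ 2 + ε) ^ ((s - 1) / 2) ≤ ‖x‖ ^ (s - 1) := by
  rw [← norm_sq_rpow_half]
  have : 0 < ‖x‖ := norm_pos_iff.2 hx
  exact Real.rpow_le_rpow_of_nonpos (by positivity) (by linarith) (by linarith)

lemma norm_regStretch_le {s ε : ℝ} (hs : s ≤ 1) (hε : 0 ≤ ε) {x : E} (hx : x ≠ 0) :
    ‖regStretch s ε x‖ ≤ ‖x‖ ^ s := by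
  have h0 : 0 < ‖x‖ := norm_pos_iff.2 hx
  rw [regStretch, norm_smul, Real.norm_of_nonneg (by positivity)]
  calc _ ≤ ‖x‖ ^ (s - 1) * ‖x‖ := by gcongr; exact rpow_regularization_le hs hε hx
    _ = ‖x‖ ^ s := by rw [Real.rpow_sub_one h0.ne']; field_simp

lemma norm_regStretchDeriv_le {s ε : ℝ} (hs0 : 0 < s) (hs : s ≤ 1) (hε : 0 ≤ ε) {x : E}
    (hx : x ≠ 0) : ‖regStretchDeriv s ε x‖ ≤ ‖x‖ ^ (s - 1) := by
  have h0 : 0 < ‖x‖ := norm_pos_iff.2 hx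
  refine ContinuousLinearMap.opNorm_le_bound _ (by positivity) fun v => ?_
  rw [regStretchDeriv_apply, norm_smul, Real.norm_of_nonneg (by positivity)]
  gcongr
  · exact rpow_regularization_le hs hε hx
  refine le_of_sq_le_sq ?_ (norm_nonneg v)
  set t := ‖x‖ ^ 2 + ε with ht
  have ht0 : 0 < t := by positivity
  rw [norm_add_sq_real, norm_smul, norm_smul, inner_smul_right, inner_smul_right,
    real_inner_comm, mul_pow, mul_pow, Real.norm_eq_abs, Real.norm_eq_abs, sq_abs, sq_abs]
  have key : 2 * ((s - 1) / t * (⟪v, x⟫ * ⟪v, x⟫)) + ((s - 1) / t) ^ 2 * (⟪v, x⟫ ^ 2 * ‖x‖ ^ 2)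
      = (s - 1) * (2 * t + (s - 1) * ‖x‖ ^ 2) * ⟪v, x⟫ ^ 2 / t ^ 2 := by
    field_simp
  have h2 : 0 ≤ 2 * t + (s - 1) * ‖x‖ ^ 2 := by nlinarith [sq_nonneg ‖x‖]
  have h3 : (s - 1) * (2 * t + (s - 1) * ‖x‖ ^ 2) * ⟪v, x⟫ ^ 2 / t ^ 2 ≤ 0 :=
    div_nonpos_of_nonpos_of_nonneg
      (mul_nonpos_of_nonpos_of_nonneg (mul_nonpos_of_nonpos_of_nonneg (by linarith) h2)
        (sq_nonneg _)) (sq_nonneg _)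
  linarith

lemma tendsto_regStretch (s : ℝ) {x : E} (hx : x ≠ 0) :
    Tendsto (fun ε => regStretch s ε x) (𝓝[>] 0) (𝓝 (regStretch s 0 x)) := by
  have h0 : ‖x‖ ^ 2 + 0 ≠ 0 := by simpa using hx
  refine tendsto_nhdsWithin_of_tendsto_nhds (ContinuousAt.tendsto ?_)
  unfold regStretch
  fun_prop (disch := exact Or.inl h0)

lemma tendsto_regStretchDeriv_apply (s : ℝ) {x : E} (hx : x ≠ 0) (v : E) :
    Tendsto (fun ε => regStretchDeriv s ε x v) (𝓝[>] 0) (𝓝 (regStretchDeriv s 0 x v)) := by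
  have h0 : ‖x‖ ^ 2 + 0 ≠ 0 := by simpa using hx
  refine tendsto_nhdsWithin_of_tendsto_nhds (ContinuousAt.tendsto ?_)
  simp only [regStretchDeriv_apply]
  fun_prop (disch := first | exact Or.inl h0 | exact h0)

lemma continuous_regStretch (s : ℝ) {ε : ℝ} (hε : 0 < ε) :
    Continuous (regStretch s ε : E → E) := by
  have h (x : E) : ‖x‖ ^ 2 + ε ≠ 0 := by positivity
  have hw : Continuous fun x : E => (‖x‖ ^ 2 + ε) ^ ((s - 1) / 2) :=
    Continuous.rpow_const (by fun_prop) fun x => Or.inl (h x)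
  exact hw.smul continuous_id

lemma continuous_regStretchDeriv_apply (s : ℝ) {ε : ℝ} (hε : 0 < ε) (v : E) :
    Continuous (fun x : E => regStretchDeriv s ε x v) := by
  have h (x : E) : ‖x‖ ^ 2 + ε ≠ 0 := by positivity
  have hw : Continuous fun x : E => (‖x‖ ^ 2 + ε) ^ ((s - 1) / 2) :=
    Continuous.rpow_const (by fun_prop) fun x => Or.inl (h x)
  simp only [regStretchDeriv_apply]
  exact hw.smul (by fun_prop (disch := exact h))

lemma det_regStretchDeriv_zero [FiniteDimensional ℝ E] (s : ℝ) {x : E} (hx : x ≠ 0) :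
    (regStretchDeriv s 0 x).det = (‖x‖ ^ (s - 1)) ^ Module.finrank ℝ E * s := by
  have h0 : ‖x‖ ≠ 0 := norm_ne_zero_iff.2 hx
  have h : (regStretchDeriv s 0 x).toLinearMap = ‖x‖ ^ (s - 1) •
      LinearMap.transvection (innerₛₗ ℝ x) (((s - 1) / ‖x‖ ^ 2) • x) := by
    ext v
    simp only [ContinuousLinearMap.coe_coe, regStretchDeriv_apply,
      LinearMap.smul_apply, LinearMap.transvection.apply, innerₛₗ_apply_apply]
    rw [norm_sq_rpow_half, add_zero, smul_comm ⟪x, v⟫]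
  rw [ContinuousLinearMap.det, h, LinearMap.det_smul, LinearMap.transvection.det,
    innerₛₗ_apply_apply, inner_smul_right, real_inner_self_eq_norm_sq]
  congr 1
  field_simp
  ring

lemma norm_norm_rpow_smul {s : ℝ} (hs : 0 < s) (x : E) : ‖‖x‖ ^ (s - 1) • x‖ = ‖x‖ ^ s := by
  rcases eq_or_ne x 0 with rfl | hx
  · simp [Real.zero_rpow hs.ne']
  have h0 : ‖x‖ ≠ 0 := norm_ne_zero_iff.2 hx
  rw [norm_smul, Real.norm_of_nonneg (by positivity), Real.rpow_sub_one h0]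
  field_simp

lemma continuous_norm_rpow_smul {s : ℝ} (hs : 0 < s) :
    Continuous (fun x : E => ‖x‖ ^ (s - 1) • x) := by
  rw [continuous_iff_continuousAt]
  intro x
  rcases eq_or_ne x 0 with rfl | hx
  · rw [ContinuousAt, smul_zero, tendsto_zero_iff_norm_tendsto_zero]
    simp only [norm_norm_rpow_smul hs]
    have : Continuous fun y : E => ‖y‖ ^ s := continuous_norm.rpow_const fun _ => Or.inr hs.le
    simpa [Real.zero_rpow hs.ne'] using this.tendsto 0
  · have h0 : ‖x‖ ≠ 0 := norm_ne_zero_iff.2 hx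
    fun_prop (disch := exact Or.inl h0)

lemma norm_rpow_smul_comp {s t : ℝ} (hs : 0 < s) (hst : s * t = 1) (x : E) :
    ‖‖x‖ ^ (s - 1) • x‖ ^ (t - 1) • ‖x‖ ^ (s - 1) • x = x := by
  rcases eq_or_ne x 0 with rfl | hx
  · simp
  have h0 : 0 < ‖x‖ := norm_pos_iff.2 hx
  rw [norm_norm_rpow_smul hs, smul_smul, ← Real.rpow_mul h0.le, ← Real.rpow_add h0]
  have : s * (t - 1) + (s - 1) = 0 := by linarith
  rw [this, Real.rpow_zero, one_smul]

/-- The radial stretch `x ↦ ‖x‖ ^ (s - 1) • x` as a homeomorphism. -/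
def radialStretch (E : Type*) [NormedAddCommGroup E] [InnerProductSpace ℝ E] {s : ℝ}
    (hs : 0 < s) : E ≃ₜ E where
  toFun x := ‖x‖ ^ (s - 1) • x
  invFun x := ‖x‖ ^ (s⁻¹ - 1) • x
  left_inv := norm_rpow_smul_comp hs (mul_inv_cancel₀ hs.ne')
  right_inv := norm_rpow_smul_comp (inv_pos.2 hs) (inv_mul_cancel₀ hs.ne')
  continuous_toFun := continuous_norm_rpow_smul hs
  continuous_invFun := continuous_norm_rpow_smul (inv_pos.2 hs)

section Integration

variable [FiniteDimensional ℝ E] [MeasurableSpace E] [BorelSpace E]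

lemma measurable_regStretchDeriv (s ε : ℝ) :
    StronglyMeasurable (regStretchDeriv s ε : E → E →L[ℝ] E) := by
  have h1 : Measurable fun x : E => (‖x‖ ^ 2 + ε) ^ ((s - 1) / 2) := by fun_prop
  have h2 : Measurable fun x : E => (s - 1) / (‖x‖ ^ 2 + ε) := by fun_prop
  have h3 : Continuous fun x : E => InnerProductSpace.rankOne ℝ x x :=
    (InnerProductSpace.rankOne ℝ).continuous.clm_apply continuous_id
  exact h1.stronglyMeasurable.smul
    (stronglyMeasurable_const.add (h2.stronglyMeasurable.smul h3.stronglyMeasurable))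

variable [Nontrivial E] (μ : Measure E) [μ.IsAddHaarMeasure]

lemma integrableOn_norm_rpow_ball {a : ℝ} (ha : -(Module.finrank ℝ E : ℝ) < a) {R : ℝ}
    (hR : 0 < R) : IntegrableOn (fun x : E => ‖x‖ ^ a) (ball 0 R) μ := by
  rw [integrableOn_fun_norm_addHaar μ (f := fun y => y ^ a)]
  have h : IntegrableOn (fun y : ℝ => y ^ ((Module.finrank ℝ E : ℝ) - 1 + a)) (Ioo 0 R) :=
    (intervalIntegral.integrableOn_Ioo_rpow_iff hR).2 (by linarith)
  refine h.congr_fun (fun y hy => ?_) measurableSet_Ioo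
  have hd : 1 ≤ Module.finrank ℝ E := Module.finrank_pos
  simp only [smul_eq_mul]
  rw [Real.rpow_add hy.1, ← Real.rpow_natCast, Nat.cast_sub hd, Nat.cast_one]

lemma integrable_mul_norm_rpow {a : ℝ} (ha : -(Module.finrank ℝ E : ℝ) < a) {f : E → ℝ}
    (hf : Continuous f) (hc : HasCompactSupport f) :
    Integrable (fun x => f x * ‖x‖ ^ a) μ := by
  obtain ⟨R, hR, hsub⟩ := hc.isCompact.isBounded.subset_ball_lt 0 0
  obtain ⟨C, hC⟩ := hf.bounded_above_of_compact_support hc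
  have h := (integrableOn_norm_rpow_ball μ ha hR).bdd_mul hf.aestronglyMeasurable
    (Eventually.of_forall hC)
  refine (integrableOn_iff_integrable_of_support_subset fun x hx => hsub ?_).1 h
  exact subset_tsupport f (left_ne_zero_of_mul hx)

/-- The pointwise differential of the radial stretch is its weak differential. -/
lemma integral_fderiv_mul_inner_norm_rpow_smul {s : ℝ} (hs0 : 0 < s) (hs : s ≤ 1) {φ : E → ℝ}
    (hφ : ContDiff ℝ 1 φ) (hc : HasCompactSupport φ) (v w : E) :
    ∫ x, fderiv ℝ φ x v * ⟪regStretch s 0 x, w⟫ ∂μ =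
      -∫ x, φ x * ⟪regStretchDeriv s 0 x v, w⟫ ∂μ := by
  have hφ' : Continuous fun x => fderiv ℝ φ x v :=
    (hφ.continuous_fderiv one_ne_zero).clm_apply continuous_const
  have hc' : HasCompactSupport fun x => fderiv ℝ φ x v := hc.fderiv_apply ℝ v
  have hne : ∀ᵐ x ∂μ, x ≠ 0 := Measure.ae_ne μ 0
  have hd : (1 : ℝ) ≤ Module.finrank ℝ E := by exact_mod_cast Module.finrank_pos
  have hreg : ∀ ε ∈ Ioi (0 : ℝ), ∫ x, fderiv ℝ φ x v * ⟪regStretch s ε x, w⟫ ∂μ =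
      -∫ x, φ x * ⟪regStretchDeriv s ε x v, w⟫ ∂μ := by
    intro ε hε
    have hε : 0 < ε := hε
    have hder (x : E) : HasFDerivAt (fun y => ⟪regStretch s ε y, w⟫)
        ((innerSL ℝ w).comp (regStretchDeriv s ε x)) x := by
      have := (innerSL ℝ w).hasFDerivAt.comp x
        (hasFDerivAt_regStretch (s := s) (ε := ε) (x := x) (by positivity))
      exact this.congr_of_eventuallyEq (Eventually.of_forall fun y => real_inner_comm _ _)
    have hfd (x : E) : fderiv ℝ (fun y => ⟪regStretch s ε y, w⟫) x v =
        ⟪regStretchDeriv s ε x v, w⟫ := by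
      rw [(hder x).fderiv]
      exact real_inner_comm _ _
    have hF : Continuous fun x : E => ⟪regStretch s ε x, w⟫ :=
      (continuous_regStretch s hε).inner continuous_const
    have hDF : Continuous fun x : E => ⟪regStretchDeriv s ε x v, w⟫ :=
      (continuous_regStretchDeriv_apply s hε v).inner continuous_const
    have := integral_mul_fderiv_eq_neg_fderiv_mul_of_integrable (μ := μ) (v := v)
      (f := φ) (g := fun x => ⟪regStretch s ε x, w⟫)
      ((hφ'.mul hF).integrable_of_hasCompactSupport hc'.mul_right)
      (by
        simp only [hfd]
        exact (hφ.continuous.mul hDF).integrable_of_hasCompactSupport hc.mul_right)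
      ((hφ.continuous.mul hF).integrable_of_hasCompactSupport hc.mul_right)
      (fun x _ => hφ.differentiable one_ne_zero x) (fun x _ => (hder x).differentiableAt)
    simp only [hfd] at this
    rw [this, neg_neg]
  have hlhs : Tendsto (fun ε => ∫ x, fderiv ℝ φ x v * ⟪regStretch s ε x, w⟫ ∂μ) (𝓝[>] 0)
      (𝓝 (∫ x, fderiv ℝ φ x v * ⟪regStretch s 0 x, w⟫ ∂μ)) := by
    refine tendsto_integral_filter_of_dominated_convergence
      (fun x => ‖fderiv ℝ φ x v * ‖x‖ ^ s‖ * ‖w‖) ?_ ?_ ?_ ?_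
    · filter_upwards [self_mem_nhdsWithin] with ε hε
      exact (hφ'.mul ((continuous_regStretch s hε).inner continuous_const)).aestronglyMeasurable
    · filter_upwards [self_mem_nhdsWithin] with ε hε
      filter_upwards [hne] with x hx
      rw [norm_mul, norm_mul, mul_assoc]
      gcongr
      refine (norm_inner_le_norm _ _).trans ?_
      gcongr
      rw [Real.norm_of_nonneg (by positivity)]
      exact norm_regStretch_le hs (mem_Ioi.1 hε).le hx
    · exact (integrable_mul_norm_rpow μ (by linarith) hφ' hc').norm.mul_const _
    · filter_upwards [hne] with x hx
      exact ((tendsto_regStretch s hx).inner tendsto_const_nhds).const_mul _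
  have hrhs : Tendsto (fun ε => ∫ x, φ x * ⟪regStretchDeriv s ε x v, w⟫ ∂μ) (𝓝[>] 0)
      (𝓝 (∫ x, φ x * ⟪regStretchDeriv s 0 x v, w⟫ ∂μ)) := by
    refine tendsto_integral_filter_of_dominated_convergence
      (fun x => ‖φ x * ‖x‖ ^ (s - 1)‖ * (‖v‖ * ‖w‖)) ?_ ?_ ?_ ?_
    · filter_upwards [self_mem_nhdsWithin] with ε hε
      exact (hφ.continuous.mul
        ((continuous_regStretchDeriv_apply s hε v).inner continuous_const)).aestronglyMeasurable
    · filter_upwards [self_mem_nhdsWithin] with ε hε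
      filter_upwards [hne] with x hx
      rw [norm_mul, norm_mul, mul_assoc, ← mul_assoc _ ‖v‖]
      gcongr
      refine (norm_inner_le_norm _ _).trans ?_
      gcongr
      rw [Real.norm_of_nonneg (by positivity)]
      exact (regStretchDeriv s ε x).le_of_opNorm_le
        (norm_regStretchDeriv_le hs0 hs (mem_Ioi.1 hε).le hx) v
    · exact (integrable_mul_norm_rpow μ (by linarith) hφ.continuous hc).norm.mul_const _
    · filter_upwards [hne] with x hx
      exact ((tendsto_regStretchDeriv_apply s hx v).inner tendsto_const_nhds).const_mul _
  exact tendsto_nhds_unique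
    (hlhs.congr' (eventually_nhdsWithin_of_forall hreg)) hrhs.neg

end Integration

end RadialStretch

lemma isQuasiconformal_radialStretch {s K : ℝ} (hs0 : 0 < s) (hs : s ≤ 1) (hK : 1 ≤ K * s) :
    IsQuasiconformal K (radialStretch (Euc 3) hs0) := by
  have hne : ∀ᵐ x ∂(volume : Measure (Euc 3)), x ≠ 0 := Measure.ae_ne volume 0
  have hcube (x : Euc 3) (hx : x ≠ 0) :
      ‖regStretchDeriv s 0 x‖ ^ 3 ≤ (‖x‖ ^ (s - 1)) ^ 3 := by
    gcongr
    exact norm_regStretchDeriv_le hs0 hs le_rfl hx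
  have hF : ⇑(radialStretch (Euc 3) hs0) = regStretch s 0 :=
    funext fun x => (regStretch_zero s x).symm
  refine ⟨regStretchDeriv s 0, fun R hR => ?_, fun φ hφ hc v w => ?_, ?_⟩
  · have hint : IntegrableOn (fun x : Euc 3 => ‖x‖ ^ ((s - 1) * 3)) (ball 0 R) volume :=
      integrableOn_norm_rpow_ball volume (by simp; linarith) hR
    refine hint.mono' ((measurable_regStretchDeriv s 0).norm.pow 3).aestronglyMeasurable ?_
    filter_upwards [ae_restrict_of_ae hne] with x hx
    rw [Real.norm_of_nonneg (by positivity), Real.rpow_mul (norm_nonneg x)]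
    exact_mod_cast hcube x hx
  · rw [hF]
    exact integral_fderiv_mul_inner_norm_rpow_smul volume hs0 hs
      (hφ.of_le (by exact_mod_cast le_top)) hc v w
  · filter_upwards [hne] with x hx
    rw [det_regStretchDeriv_zero s hx, finrank_euclideanSpace_fin]
    calc _ ≤ (‖x‖ ^ (s - 1)) ^ 3 * 1 := by rw [mul_one]; exact hcube x hx
      _ ≤ (‖x‖ ^ (s - 1)) ^ 3 * (K * s) := by gcongr
      _ = _ := by ring

/-- The parametrization of the spiral shell is homogeneous in its radius. -/
lemma norm_rpow_smul_spherical {ρ : ℝ} (hρ : 0 < ρ) (s u v : ℝ) :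
    ‖(WithLp.equiv 2 (Fin 3 → ℝ)).symm
      ![ρ * Real.cos u * Real.sin v, ρ * Real.sin u * Real.sin v, ρ * Real.cos v]‖ ^ (s - 1) •
      (WithLp.equiv 2 (Fin 3 → ℝ)).symm
        ![ρ * Real.cos u * Real.sin v, ρ * Real.sin u * Real.sin v, ρ * Real.cos v] =
      (WithLp.equiv 2 (Fin 3 → ℝ)).symm
        ![ρ ^ s * Real.cos u * Real.sin v, ρ ^ s * Real.sin u * Real.sin v,
          ρ ^ s * Real.cos v] := by
  have hnorm : ‖(WithLp.equiv 2 (Fin 3 → ℝ)).symm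
      ![ρ * Real.cos u * Real.sin v, ρ * Real.sin u * Real.sin v, ρ * Real.cos v]‖ = ρ := by
    rw [EuclideanSpace.norm_eq, Real.sqrt_eq_iff_mul_self_eq (by positivity) hρ.le]
    simp only [Fin.sum_univ_three, Real.norm_eq_abs, sq_abs, WithLp.equiv_symm_apply,
      Matrix.cons_val]
    linear_combination ρ ^ 2 * Real.sin v ^ 2 * Real.sin_sq_add_cos_sq u
      + ρ ^ 2 * Real.sin_sq_add_cos_sq v
  have hpow : ρ ^ s = ρ ^ (s - 1) * ρ := by
    rw [Real.rpow_sub_one hρ.ne']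
    field_simp
  rw [hnorm, hpow]
  ext i
  fin_cases i <;> simp [mul_assoc]

lemma radialStretch_image_spiralShell {p s : ℝ} (hs : 0 < s) :
    radialStretch (Euc 3) hs '' spiralShell p = spiralShell (p * s) := by
  have key (u v : ℝ) (hu : 1 ≤ u) := norm_rpow_smul_spherical
    (Real.rpow_pos_of_pos (one_pos.trans_le hu) (-p)) s u v
  have hpow (u : ℝ) (hu : 1 ≤ u) : (u ^ (-p)) ^ s = u ^ (-(p * s)) := by
    rw [← Real.rpow_mul (by linarith), neg_mul]
  ext y
  constructor
  · rintro ⟨_, ⟨u, v, hu, hv, rfl⟩, rfl⟩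
    refine ⟨u, v, hu, hv, ?_⟩
    rw [← hpow u hu]
    exact key u v hu
  · rintro ⟨u, v, hu, hv, rfl⟩
    refine ⟨_, ⟨u, v, hu, hv, rfl⟩, ?_⟩
    rw [← hpow u hu]
    exact key u v hu

/-- **Theorem (quasiconformal maps between spiral shells exist for `K ≥ p/q`).**
For `p ≥ q > 0` and every `K ≥ p/q` there is a `K`-quasiconformal homeomorphism
`F : ℝ³ → ℝ³` with `F(𝒮_p) = 𝒮_q`; indeed the radial stretch `F x = |x|^{q/p-1} x`
(`F 0 = 0`) is `(p/q)`-quasiconformal, hence `K`-quasiconformal, and maps `𝒮_p` onto `𝒮_q`. -/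
theorem exists_quasiconformal_shell_map (p q : ℝ) (hq : 0 < q) (hpq : q ≤ p) :
    ∀ K : ℝ, p / q ≤ K →
      ∃ F : Euc 3 ≃ₜ Euc 3, (∀ x : Euc 3, F x = ‖x‖ ^ (q / p - 1) • x) ∧
        IsQuasiconformal K ⇑F ∧ ⇑F '' spiralShell p = spiralShell q := by
  intro K hK
  have hp : 0 < p := hq.trans_le hpq
  have hs : 0 < q / p := div_pos hq hp
  refine ⟨radialStretch (Euc 3) hs, fun x => rfl,
    isQuasiconformal_radialStretch hs ((div_le_one hp).2 hpq) ?_, ?_⟩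
  · calc (1 : ℝ) = p / q * (q / p) := by field_simp
      _ ≤ K * (q / p) := by gcongr
  · rw [radialStretch_image_spiralShell, mul_div_cancel₀ _ hp.ne']
end
end

section
/- Let p > 0 and let 𝒮_p ⊆ ℝ³ be the polynomial spiral shell. For every θ ∈ (0,1), the θ-Assouad spectrum of 𝒮_p is given by: if p ≤ 1/2, then dim_A^θ 𝒮_p = min{ 3/((1+p)(1−θ)), 3 }; and if p > 1/2, then dim_A^θ 𝒮_p = min{ 2 + θ/(p(1−θ)), 3 }. In particular dim_A^θ 𝒮_p = 3 for all θ ∈ [p/(p+1), 1). -/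
open Metric Set Filter MeasureTheory Topology
open scoped RealInnerProductSpace

noncomputable section

/-! ### Counting mesh cubes -/

/-- The indices of the mesh cubes met by `E`. -/
def meshCubes (d : ℕ) (r : ℝ) (E : Set (Euc d)) : Set (Fin d → ℤ) :=
  {k | ∃ x ∈ E, ∀ i, (k i : ℝ) * r ≤ x i ∧ x i < ((k i : ℝ) + 1) * r}

lemma meshCubeCount_eq (d : ℕ) (r : ℝ) (E : Set (Euc d)) :
    meshCubeCount d r E = (meshCubes d r E).ncard := rfl

lemma abs_coord_sub_le_dist {d : ℕ} (x y : Euc d) (i : Fin d) : |x i - y i| ≤ dist x y := by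
  rw [dist_eq_norm]
  simpa [Real.norm_eq_abs] using PiLp.norm_apply_le (x - y) i

/-- A set of diameter at most `D * r` meets at most `(2 * D + 3) ^ d` cubes of the `r`-mesh. -/
lemma meshCubes_of_dist_le {d : ℕ} {r : ℝ} (hr : 0 < r) {E : Set (Euc d)} (D : ℕ)
    (hE : ∀ x ∈ E, ∀ y ∈ E, dist x y ≤ D * r) :
    (meshCubes d r E).Finite ∧ meshCubeCount d r E ≤ (2 * D + 3) ^ d := by
  rcases E.eq_empty_or_nonempty with rfl | ⟨e, he⟩
  · have : meshCubes d r (∅ : Set (Euc d)) = ∅ := by simp [meshCubes]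
    simp [meshCubeCount_eq, this]
  have hsub : meshCubes d r E ⊆ ↑(Fintype.piFinset fun i : Fin d =>
      Finset.Icc (⌊e i / r⌋ - (D + 1)) (⌊e i / r⌋ + (D + 1) : ℤ)) := by
    rintro k ⟨x, hx, hk⟩
    simp only [Fintype.coe_piFinset, Finset.coe_Icc, Set.mem_pi, Set.mem_univ, forall_const,
      Set.mem_Icc]
    intro i
    have h1 := abs_le.1 ((abs_coord_sub_le_dist x e i).trans (hE x hx e he))
    obtain ⟨h2, h3⟩ := hk i
    have h4 : (⌊e i / r⌋ : ℝ) * r ≤ e i := (le_div_iff₀ hr).1 (Int.floor_le _)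
    have h5 : e i < (⌊e i / r⌋ + 1 : ℝ) * r := (div_lt_iff₀ hr).1 (Int.lt_floor_add_one _)
    have h6 : (⌊e i / r⌋ : ℝ) < k i + (D + 1) := by
      by_contra hcon
      push Not at hcon
      nlinarith [mul_le_mul_of_nonneg_right hcon hr.le]
    have h7 : (k i : ℝ) < ⌊e i / r⌋ + (D + 1) := by
      by_contra hcon
      push Not at hcon
      nlinarith [mul_le_mul_of_nonneg_right hcon hr.le]
    have h8 : ⌊e i / r⌋ < k i + (D + 1) := by exact_mod_cast h6
    have h9 : k i < ⌊e i / r⌋ + (D + 1) := by exact_mod_cast h7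
    constructor <;> linarith
  refine ⟨(Finset.finite_toSet _).subset hsub, ?_⟩
  rw [meshCubeCount_eq]
  refine (Set.ncard_le_ncard hsub (Finset.finite_toSet _)).trans ?_
  rw [Set.ncard_coe_finset, Fintype.card_piFinset]
  simp only [Int.card_Icc]
  rw [Finset.prod_congr rfl (g := fun _ => 2 * D + 3) (by intro i _; omega)]
  simp

lemma meshCubes_mono {d : ℕ} {r : ℝ} {E F : Set (Euc d)} (h : E ⊆ F) :
    meshCubes d r E ⊆ meshCubes d r F := fun _ ⟨x, hx, hk⟩ => ⟨x, h hx, hk⟩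

lemma meshCubes_finite_ball {d : ℕ} {r : ℝ} (hr : 0 < r) (x : Euc d) (R : ℝ) :
    (meshCubes d r (ball x R)).Finite := by
  refine (meshCubes_of_dist_le hr ⌈2 * R / r⌉₊ fun y hy z hz => ?_).1
  have h1 := Nat.le_ceil (2 * R / r)
  rw [div_le_iff₀ hr] at h1
  have h2 := dist_triangle_right y z x
  rw [mem_ball] at hy hz
  linarith

lemma meshCubeCount_mono {d : ℕ} {r : ℝ} (hr : 0 < r) {E F : Set (Euc d)} (h : E ⊆ F)
    (x : Euc d) (R : ℝ) (hF : F ⊆ ball x R) :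
    meshCubeCount d r E ≤ meshCubeCount d r F :=
  Set.ncard_le_ncard (meshCubes_mono h) ((meshCubes_finite_ball hr x R).subset (meshCubes_mono hF))

lemma meshCubeCount_union_le {d : ℕ} {r : ℝ} (E F : Set (Euc d)) :
    meshCubeCount d r (E ∪ F) ≤ meshCubeCount d r E + meshCubeCount d r F := by
  have : meshCubes d r (E ∪ F) = meshCubes d r E ∪ meshCubes d r F := by
    ext k
    simp [meshCubes, or_and_right, exists_or]
  rw [meshCubeCount_eq, this]
  exact Set.ncard_union_le _ _

lemma meshCubeCount_biUnion_le {d : ℕ} {r : ℝ} {ι : Type*} (T : Finset ι) (E : ι → Set (Euc d)) :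
    meshCubeCount d r (⋃ i ∈ T, E i) ≤ ∑ i ∈ T, meshCubeCount d r (E i) := by
  have : meshCubes d r (⋃ i ∈ T, E i) = ⋃ i ∈ T, meshCubes d r (E i) := by
    ext k
    simp only [meshCubes, Set.mem_iUnion, Set.mem_ofPred_eq]
    constructor
    · rintro ⟨x, ⟨i, hi, hx⟩, hk⟩
      exact ⟨i, hi, x, hx, hk⟩
    · rintro ⟨i, hi, x, hx, hk⟩
      exact ⟨x, ⟨i, hi, hx⟩, hk⟩
  rw [meshCubeCount_eq, this]
  exact Finset.set_ncard_biUnion_le _ _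

/-- A set of diameter at most `2 * R`, with `r ≤ R`, meets at most `729 * (R / r) ^ 3` cubes. -/
lemma meshCubeCount_le_volume {r R : ℝ} (hr : 0 < r) (hR : r ≤ R) {E : Set (Euc 3)} (x : Euc 3)
    (hE : E ⊆ closedBall x R) : (meshCubeCount 3 r E : ℝ) ≤ 729 * (R / r) ^ 3 := by
  have h := (meshCubes_of_dist_le hr ⌈2 * R / r⌉₊ (E := E) fun y hy z hz => by
    have h1 := Nat.le_ceil (2 * R / r)
    rw [div_le_iff₀ hr] at h1
    have h2 := dist_triangle_right y z x
    have hy := mem_closedBall.1 (hE hy)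
    have hz := mem_closedBall.1 (hE hz)
    linarith).2
  have h1 : 1 ≤ R / r := (one_le_div hr).2 hR
  have h2 : (⌈2 * R / r⌉₊ : ℝ) < 2 * (R / r) + 1 := by
    rw [mul_div_assoc]
    exact Nat.ceil_lt_add_one (by positivity)
  calc (meshCubeCount 3 r E : ℝ) ≤ (2 * (⌈2 * R / r⌉₊ : ℝ) + 3) ^ 3 := by exact_mod_cast h
    _ ≤ (9 * (R / r)) ^ 3 := by gcongr; linarith
    _ = _ := by ring

/-- Slicing along a real-valued function: if the part of the image over every set where `g`
oscillates by at most `1` meets at most `B` cubes, the image of a set where `g` oscillates by at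
most `L` meets at most `(2 * L + 3) * B` cubes. -/
lemma meshCubeCount_image_le_of_slices {α : Type*} {r L B : ℝ} (hL : 0 ≤ L) (hB : 0 ≤ B)
    (F : α → Euc 3) (g : α → ℝ) (Q : Set α) (hg : ∀ q ∈ Q, ∀ q' ∈ Q, |g q - g q'| ≤ L)
    (h : ∀ Q' ⊆ Q, (∀ q ∈ Q', ∀ q' ∈ Q', |g q - g q'| ≤ 1) →
      (meshCubeCount 3 r (F '' Q') : ℝ) ≤ B) :
    (meshCubeCount 3 r (F '' Q) : ℝ) ≤ (2 * L + 3) * B := by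
  rcases Q.eq_empty_or_nonempty with rfl | ⟨e, he⟩
  · have h0 := h ∅ subset_rfl (by simp)
    nlinarith
  set S : ℤ → Set α := fun j => {q ∈ Q | ⌊g q - g e⌋ = j} with hS
  set T : Finset ℤ := Finset.Icc (-⌈L⌉) ⌈L⌉ with hT
  have hcov : F '' Q = ⋃ j ∈ T, F '' S j := by
    ext y
    simp only [Set.mem_iUnion, exists_prop, Set.mem_image]
    constructor
    · rintro ⟨q, hq, rfl⟩
      refine ⟨⌊g q - g e⌋, ?_, q, ⟨hq, rfl⟩, rfl⟩
      have h1 := abs_le.1 (hg q hq e he)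
      rw [hT, Finset.mem_Icc]
      constructor
      · rw [← Int.floor_neg]
        exact Int.floor_le_floor h1.1
      · exact (Int.floor_le_floor h1.2).trans (Int.floor_le_ceil L)
    · rintro ⟨j, -, q, hq, rfl⟩
      exact ⟨q, hq.1, rfl⟩
  have hcard : (T.card : ℝ) ≤ 2 * L + 3 := by
    have h0 : 0 ≤ ⌈L⌉ := Int.ceil_nonneg hL
    have h1 : (T.card : ℤ) = 2 * ⌈L⌉ + 1 := by
      rw [hT, Int.card_Icc]
      omega
    have h2 : (T.card : ℝ) = 2 * ⌈L⌉ + 1 := by exact_mod_cast h1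
    have := Int.ceil_lt_add_one L
    linarith
  calc (meshCubeCount 3 r (F '' Q) : ℝ) ≤ ∑ j ∈ T, (meshCubeCount 3 r (F '' S j) : ℝ) := by
        rw [hcov]
        exact_mod_cast meshCubeCount_biUnion_le T fun j => F '' S j
    _ ≤ ∑ _j ∈ T, B := by
        refine Finset.sum_le_sum fun j _ => h _ (fun q hq => hq.1) ?_
        rintro q ⟨hq, rfl⟩ q' ⟨hq', hj⟩
        exact (Int.abs_sub_lt_one_of_floor_eq_floor hj.symm).le.trans' (by simp)
    _ = T.card * B := by simp
    _ ≤ _ := by gcongr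

/-- A `2 * r`-separated family of points meets pairwise distinct cubes of the `r`-mesh. -/
lemma card_le_meshCubeCount {ι : Type*} {r : ℝ} (hr : 0 < r) (T : Finset ι) (f : ι → Euc 3)
    {E : Set (Euc 3)} (x : Euc 3) (R : ℝ) (hE : E ⊆ ball x R) (hf : ∀ i ∈ T, f i ∈ E)
    (hsep : ∀ i ∈ T, ∀ j ∈ T, i ≠ j → 2 * r ≤ dist (f i) (f j)) :
    T.card ≤ meshCubeCount 3 r E := by
  rw [← Set.ncard_coe_finset, meshCubeCount_eq]
  refine Set.ncard_le_ncard_of_injOn (fun i c => ⌊f i c / r⌋) ?_ ?_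
    ((meshCubes_finite_ball hr x R).subset (meshCubes_mono hE))
  · intro i hi
    exact ⟨f i, hf i hi, fun c => ⟨(le_div_iff₀ hr).1 (Int.floor_le _),
      (div_lt_iff₀ hr).1 (Int.lt_floor_add_one _)⟩⟩
  · intro i hi j hj hij
    by_contra hne
    have h1 := hsep i hi j hj hne
    have h2 : ∀ c, |f i c - f j c| ≤ r := by
      intro c
      have h3 := Int.abs_sub_lt_one_of_floor_eq_floor (congrFun hij c)
      rw [← sub_div, abs_div, abs_of_pos hr, div_lt_one hr] at h3
      exact h3.le
    rw [EuclideanSpace.dist_eq, Real.le_sqrt (by positivity) (by positivity),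
      Fin.sum_univ_three] at h1
    simp only [Real.dist_eq] at h1
    have h4 : ∀ c, |f i c - f j c| ^ 2 ≤ r ^ 2 := fun c =>
      pow_le_pow_left₀ (abs_nonneg _) (h2 c) 2
    nlinarith [h4 0, h4 1, h4 2, pow_pos hr 2]

/-! ### Geometry of the spiral shell -/

/-- The parametrization of the spiral shell; the sign `s = ±1` lets the polar angle `v` be
restricted to `[0, π]`. -/
def spiralPt (p s u v : ℝ) : Euc 3 :=
  !₂[s * (u ^ (-p) * Real.cos u * Real.sin v), s * (u ^ (-p) * Real.sin u * Real.sin v),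
    u ^ (-p) * Real.cos v]

lemma dist_spiralPt_sq {p s : ℝ} (hs : s ^ 2 = 1) (u v u' v' : ℝ) :
    dist (spiralPt p s u v) (spiralPt p s u' v') ^ 2 =
      (u ^ (-p) - u' ^ (-p)) ^ 2 + u ^ (-p) * u' ^ (-p) *
        (4 * Real.sin ((v - v') / 2) ^ 2 +
          4 * Real.sin v * Real.sin v' * Real.sin ((u - u') / 2) ^ 2) := by
  rw [EuclideanSpace.dist_eq, Real.sq_sqrt (by positivity), Fin.sum_univ_three]
  simp only [Real.dist_eq, sq_abs, spiralPt, Matrix.cons_val_zero, Matrix.cons_val_one,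
    Matrix.cons_val]
  have half : ∀ x y : ℝ, 2 * Real.sin ((x - y) / 2) ^ 2 =
      1 - (Real.cos x * Real.cos y + Real.sin x * Real.sin y) := by
    intro x y
    have h := Real.cos_sq_add_sin_sq ((x - y) / 2)
    have h1 := Real.cos_two_mul ((x - y) / 2)
    rw [show 2 * ((x - y) / 2) = x - y by ring, Real.cos_sub] at h1
    linarith
  have hv := half v v'
  have hu := half u u'
  have e1 : 4 * Real.sin v * Real.sin v' * Real.sin ((u - u') / 2) ^ 2 =
      2 * Real.sin v * Real.sin v' * (2 * Real.sin ((u - u') / 2) ^ 2) := by ring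
  have e2 : 4 * Real.sin ((v - v') / 2) ^ 2 = 2 * (2 * Real.sin ((v - v') / 2) ^ 2) := by ring
  rw [e1, e2, hv, hu]
  generalize u ^ (-p) = a
  generalize u' ^ (-p) = b
  have c1 := Real.cos_sq_add_sin_sq u
  have c2 := Real.cos_sq_add_sin_sq u'
  have c3 := Real.cos_sq_add_sin_sq v
  have c4 := Real.cos_sq_add_sin_sq v'
  generalize Real.cos u = cu at *
  generalize Real.sin u = su at *
  generalize Real.cos u' = cu' at *
  generalize Real.sin u' = su' at *
  generalize Real.cos v = cv at *
  generalize Real.sin v = sv at *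
  generalize Real.cos v' = cv' at *
  generalize Real.sin v' = sv' at *
  linear_combination ((a * cu * sv - b * cu' * sv') ^ 2 + (a * su * sv - b * su' * sv') ^ 2) * hs +
    a ^ 2 * sv ^ 2 * c1 + b ^ 2 * sv' ^ 2 * c2 + a ^ 2 * c3 + b ^ 2 * c4

lemma norm_spiralPt {p s : ℝ} (hs : s ^ 2 = 1) {u : ℝ} (hu : 0 ≤ u) (v : ℝ) :
    ‖spiralPt p s u v‖ = u ^ (-p) := by
  have h0 : 0 ≤ u ^ (-p) := Real.rpow_nonneg hu _
  rw [EuclideanSpace.norm_eq, Real.sqrt_eq_iff_mul_self_eq (by positivity) h0, Fin.sum_univ_three]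
  simp only [Real.norm_eq_abs, sq_abs, spiralPt, Matrix.cons_val_zero, Matrix.cons_val_one,
    Matrix.cons_val]
  linear_combination (u ^ (-p) * Real.sin v) ^ 2 * Real.cos_sq_add_sin_sq u
    + (u ^ (-p)) ^ 2 * Real.cos_sq_add_sin_sq v
    + (u ^ (-p) * Real.sin v) ^ 2 * (Real.cos u ^ 2 + Real.sin u ^ 2) * hs

lemma spiralPt_one_mem {p u v : ℝ} (hu : 1 ≤ u) (hv : 1 ≤ v) :
    spiralPt p 1 u v ∈ spiralShell p :=
  ⟨u, v, hu, hv, by simp [spiralPt]⟩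

/-- Every point of the spiral shell has polar angle in `[0, π]`, up to the choice of a sign. -/
lemma exists_spiralPt_of_mem {p : ℝ} {x : Euc 3} (hx : x ∈ spiralShell p) :
    ∃ s u v : ℝ, (s = 1 ∨ s = -1) ∧ 1 ≤ u ∧ v ∈ Icc 0 Real.pi ∧ x = spiralPt p s u v := by
  obtain ⟨u, v, hu, -, rfl⟩ := hx
  have hcos : Real.cos (Real.arccos (Real.cos v)) = Real.cos v :=
    Real.cos_arccos (Real.neg_one_le_cos v) (Real.cos_le_one v)
  have hsin : Real.sin (Real.arccos (Real.cos v)) = |Real.sin v| := by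
    rw [Real.sin_arccos, Real.abs_sin_eq_sqrt_one_sub_cos_sq]
  have hmem : Real.arccos (Real.cos v) ∈ Icc 0 Real.pi :=
    ⟨Real.arccos_nonneg _, Real.arccos_le_pi _⟩
  rcases le_total 0 (Real.sin v) with h | h
  · refine ⟨1, u, _, Or.inl rfl, hu, hmem, ?_⟩
    simp [spiralPt, hcos, hsin, abs_of_nonneg h]
  · refine ⟨-1, u, _, Or.inr rfl, hu, hmem, ?_⟩
    simp [spiralPt, hcos, hsin, abs_of_nonpos h]

/-- The graph of `x ↦ x ^ (-p)` lies above its tangents. -/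
lemma rpow_neg_tangent_le {p x y : ℝ} (hx : 0 < x) (hy : 0 < y) (hp : 0 < p) :
    x ^ (-p) - p * x ^ (-p - 1) * (y - x) ≤ y ^ (-p) := by
  have h1 : 1 - p * (y / x - 1) ≤ (y / x) ^ (-p) := by
    rw [Real.rpow_def_of_pos (div_pos hy hx)]
    have h2 := Real.add_one_le_exp (Real.log (y / x) * -p)
    have h3 := Real.log_le_sub_one_of_pos (div_pos hy hx)
    nlinarith [mul_le_mul_of_nonneg_left h3 hp.le]
  have hxp : 0 < x ^ (-p) := Real.rpow_pos_of_pos hx _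
  rw [Real.div_rpow hy.le hx.le, le_div_iff₀ hxp] at h1
  refine le_trans (le_of_eq ?_) h1
  rw [Real.rpow_sub_one hx.ne']
  field_simp

/-- On `[A, B]`, `x ↦ x ^ (-p)` is bi-Lipschitz with constants `p * B ^ (-p - 1)` and
`p * A ^ (-p - 1)`. -/
lemma abs_rpow_neg_sub_mem {p A B x y : ℝ} (hp : 0 < p) (hA : 0 < A) (hx : x ∈ Icc A B)
    (hy : y ∈ Icc A B) :
    p * B ^ (-p - 1) * |x - y| ≤ |x ^ (-p) - y ^ (-p)| ∧
      |x ^ (-p) - y ^ (-p)| ≤ p * A ^ (-p - 1) * |x - y| := by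
  wlog hxy : x ≤ y generalizing x y
  · have := this hy hx (le_of_not_ge hxy)
    rwa [abs_sub_comm x y, abs_sub_comm (x ^ (-p))]
  have hx0 : 0 < x := hA.trans_le hx.1
  have hy0 : 0 < y := hA.trans_le hy.1
  have h1 := rpow_neg_tangent_le hx0 hy0 hp
  have h2 := rpow_neg_tangent_le hy0 hx0 hp
  have h3 : x ^ (-p - 1) ≤ A ^ (-p - 1) := Real.rpow_le_rpow_of_nonpos hA hx.1 (by linarith)
  have h4 : B ^ (-p - 1) ≤ y ^ (-p - 1) := Real.rpow_le_rpow_of_nonpos hy0 hy.2 (by linarith)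
  have h5 : y ^ (-p) ≤ x ^ (-p) := Real.rpow_le_rpow_of_nonpos hx0 hxy (by linarith)
  rw [abs_sub_comm x y, abs_of_nonneg (sub_nonneg.2 hxy), abs_of_nonneg (sub_nonneg.2 h5)]
  have h6 := mul_le_mul_of_nonneg_right h3 (mul_nonneg hp.le (sub_nonneg.2 hxy))
  have h7 := mul_le_mul_of_nonneg_right h4 (mul_nonneg hp.le (sub_nonneg.2 hxy))
  constructor <;> nlinarith

lemma abs_div_pi_le_abs_sin_half {t : ℝ} (ht : |t| ≤ Real.pi) :
    |t| / Real.pi ≤ |Real.sin (t / 2)| := by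
  have h := Real.mul_abs_le_abs_sin (x := t / 2) (by rw [abs_div, abs_two]; linarith)
  refine le_trans (le_of_eq ?_) h
  rw [abs_div, abs_two]
  ring

/-! ### Upper bounds -/

/-- The part of the spiral shell with `u ∈ [n, n + 1]`, on the side given by the sign `s`. -/
def spiralBlock (p s n : ℝ) : Set (Euc 3) :=
  {x | ∃ u ∈ Icc n (n + 1), ∃ v ∈ Icc 0 Real.pi, x = spiralPt p s u v}

/-- Lower distance bounds inside a block, in the radial, polar and azimuthal directions. -/
lemma spiralPt_dist_lower {p s n : ℝ} (hp : 0 < p) (hs : s ^ 2 = 1) (hn : 1 ≤ n)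
    {u v u' v' : ℝ} (hu : u ∈ Icc n (n + 1)) (hu' : u' ∈ Icc n (n + 1))
    (hv : v ∈ Icc 0 Real.pi) (hv' : v' ∈ Icc 0 Real.pi) :
    p * (2 * n) ^ (-p - 1) * |u - u'| ≤ dist (spiralPt p s u v) (spiralPt p s u' v') ∧
    (2 * n) ^ (-p) * (2 / Real.pi) * |v - v'| ≤ dist (spiralPt p s u v) (spiralPt p s u' v') ∧
    (2 * n) ^ (-p) * (2 / Real.pi) * min (Real.sin v) (Real.sin v') * |u - u'| ≤
      dist (spiralPt p s u v) (spiralPt p s u' v') := by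
  have hpi := Real.pi_gt_three
  have hn0 : 0 < n := by linarith
  have hD := dist_spiralPt_sq (p := p) hs u v u' v'
  have hD0 : 0 ≤ dist (spiralPt p s u v) (spiralPt p s u' v') := dist_nonneg
  set D := dist (spiralPt p s u v) (spiralPt p s u' v')
  have hS : 0 ≤ Real.sin v := Real.sin_nonneg_of_nonneg_of_le_pi hv.1 hv.2
  have hS' : 0 ≤ Real.sin v' := Real.sin_nonneg_of_nonneg_of_le_pi hv'.1 hv'.2
  have hmem : ∀ w ∈ Icc n (n + 1), (2 * n) ^ (-p) ≤ w ^ (-p) := fun w hw =>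
    Real.rpow_le_rpow_of_nonpos (hn0.trans_le hw.1) (by linarith [hw.2]) (by linarith)
  have ha := hmem u hu
  have ha' := hmem u' hu'
  have hc : 0 < (2 * n) ^ (-p) := by positivity
  have hgap := (abs_rpow_neg_sub_mem (B := 2 * n) hp hn0 ⟨hu.1, by linarith [hu.2]⟩
    ⟨hu'.1, by linarith [hu'.2]⟩).1
  set c := (2 * n) ^ (-p)
  set a := u ^ (-p)
  set a' := u' ^ (-p)
  have hcc : c ^ 2 ≤ a * a' := by nlinarith
  have hv2 : |v - v'| ≤ Real.pi := abs_le.2 ⟨by linarith [hv.1, hv'.2], by linarith [hv.2, hv'.1]⟩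
  have hu2 : |u - u'| ≤ Real.pi :=
    abs_le.2 ⟨by linarith [hu.1, hu'.2], by linarith [hu.2, hu'.1]⟩
  have sv := pow_le_pow_left₀ (by positivity) (abs_div_pi_le_abs_sin_half hv2) 2
  have su := pow_le_pow_left₀ (by positivity) (abs_div_pi_le_abs_sin_half hu2) 2
  rw [sq_abs] at sv su
  have haa : 0 ≤ a * a' := (sq_nonneg c).trans hcc
  have hss : 0 ≤ Real.sin v * Real.sin v' := mul_nonneg hS hS'
  have t1 : 0 ≤ a * a' * (4 * Real.sin ((v - v') / 2) ^ 2) :=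
    mul_nonneg (le_trans (sq_nonneg c) hcc) (by positivity)
  have t2 : 0 ≤ a * a' * (4 * Real.sin v * Real.sin v' * Real.sin ((u - u') / 2) ^ 2) :=
    mul_nonneg (le_trans (sq_nonneg c) hcc) (by nlinarith [sq_nonneg (Real.sin ((u - u') / 2))])
  refine ⟨?_, ?_, ?_⟩
  · refine hgap.trans (abs_le_of_sq_le_sq (by linarith) hD0)
  · refine le_of_sq_le_sq ?_ hD0
    have h1 : c ^ 2 * (4 * (|v - v'| / Real.pi) ^ 2) ≤
        a * a' * (4 * Real.sin ((v - v') / 2) ^ 2) := by gcongr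
    have h2 : (c * (2 / Real.pi) * |v - v'|) ^ 2 = c ^ 2 * (4 * (|v - v'| / Real.pi) ^ 2) := by
      field_simp
      ring
    nlinarith [sq_nonneg (a - a')]
  · refine le_of_sq_le_sq ?_ hD0
    set m := min (Real.sin v) (Real.sin v')
    have hm0 : 0 ≤ m := le_min hS hS'
    have hm : m ^ 2 ≤ Real.sin v * Real.sin v' := by
      rw [sq]
      exact mul_le_mul (min_le_left _ _) (min_le_right _ _) hm0 hS
    have h1 : c ^ 2 * (4 * m ^ 2 * (|u - u'| / Real.pi) ^ 2) ≤
        a * a' * (4 * (Real.sin v * Real.sin v') * Real.sin ((u - u') / 2) ^ 2) := by gcongr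
    have h2 : (c * (2 / Real.pi) * m * |u - u'|) ^ 2 =
        c ^ 2 * (4 * m ^ 2 * (|u - u'| / Real.pi) ^ 2) := by
      field_simp
      ring
    nlinarith [sq_nonneg (a - a')]

/-- Upper distance bound inside a block. -/
lemma spiralPt_dist_sq_upper {p s n : ℝ} (hp : 0 < p) (hs : s ^ 2 = 1) (hn : 1 ≤ n)
    {u v u' v' : ℝ} (hu : u ∈ Icc n (n + 1)) (hu' : u' ∈ Icc n (n + 1))
    (hv : v ∈ Icc 0 Real.pi) (hv' : v' ∈ Icc 0 Real.pi) :
    dist (spiralPt p s u v) (spiralPt p s u' v') ^ 2 ≤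
      (p * n ^ (-p - 1) * |u - u'|) ^ 2 + (n ^ (-p) * |v - v'|) ^ 2 +
        (n ^ (-p) * max (Real.sin v) (Real.sin v') * |u - u'|) ^ 2 := by
  have hn0 : 0 < n := by linarith
  rw [dist_spiralPt_sq hs]
  have hS : 0 ≤ Real.sin v := Real.sin_nonneg_of_nonneg_of_le_pi hv.1 hv.2
  have hS' : 0 ≤ Real.sin v' := Real.sin_nonneg_of_nonneg_of_le_pi hv'.1 hv'.2
  have hmem : ∀ w ∈ Icc n (n + 1), 0 ≤ w ^ (-p) ∧ w ^ (-p) ≤ n ^ (-p) := fun w hw =>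
    ⟨Real.rpow_nonneg (hn0.le.trans hw.1) _, Real.rpow_le_rpow_of_nonpos hn0 hw.1 (by linarith)⟩
  obtain ⟨ha0, ha⟩ := hmem u hu
  obtain ⟨ha0', ha'⟩ := hmem u' hu'
  have hgap := (abs_rpow_neg_sub_mem hp hn0 hu hu').2
  have hsin : ∀ t : ℝ, 4 * Real.sin (t / 2) ^ 2 ≤ |t| ^ 2 := by
    intro t
    have h := pow_le_pow_left₀ (abs_nonneg _) (Real.abs_sin_le_abs (x := t / 2)) 2
    rw [sq_abs, sq_abs] at h
    rw [sq_abs]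
    linarith
  set c := n ^ (-p)
  set a := u ^ (-p)
  set a' := u' ^ (-p)
  have hcc : a * a' ≤ c ^ 2 := by nlinarith
  set M := max (Real.sin v) (Real.sin v')
  have hM : Real.sin v * Real.sin v' ≤ M ^ 2 := by
    rw [sq]
    exact mul_le_mul (le_max_left _ _) (le_max_right _ _) hS' (hS.trans (le_max_left _ _))
  have h1 : (a - a') ^ 2 ≤ (p * n ^ (-p - 1) * |u - u'|) ^ 2 := by
    rw [← sq_abs (a - a')]
    exact pow_le_pow_left₀ (abs_nonneg _) hgap 2
  have h2 : a * a' * (4 * Real.sin ((v - v') / 2) ^ 2) ≤ c ^ 2 * |v - v'| ^ 2 := by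
    gcongr
    exact hsin _
  have h3 : a * a' * (Real.sin v * Real.sin v' * (4 * Real.sin ((u - u') / 2) ^ 2)) ≤
      c ^ 2 * (M ^ 2 * |u - u'| ^ 2) := by
    gcongr
    exact hsin _
  nlinarith

set_option maxHeartbeats 1000000 in
/-- Inside a ball of radius `R`, a block is as small as a smooth surface. -/
lemma exists_meshCubeCount_block_le {p : ℝ} (hp : 0 < p) :
    ∃ C : ℝ, 0 < C ∧ ∀ s n r R : ℝ, s ^ 2 = 1 → 1 ≤ n → 0 < r → r ≤ R → ∀ x : Euc 3,
      (meshCubeCount 3 r (ball x R ∩ spiralBlock p s n) : ℝ) ≤ C * (R / r) ^ 2 := by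
  have hpi := Real.pi_gt_three
  set c₀ : ℝ := 2 ^ (-p) with hc₀
  set c₁ : ℝ := 2 ^ (-p - 1) with hc₁
  have hc₀p : 0 < c₀ := by positivity
  have hc₁p : 0 < c₁ := by positivity
  set K₁ : ℝ := Real.pi / c₀ with hK₁
  set K₂ : ℝ := 2 / c₁ + K₁ + 1 with hK₂
  have hK₁p : 0 < K₁ := by positivity
  have hK₂p : 0 < K₂ := by positivity
  refine ⟨(2 * K₁ + 3) * ((2 * K₂ + 3) * 729), by positivity, ?_⟩
  intro s n r R hs hn hr hR x
  have hn0 : 0 < n := by linarith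
  have hRp : 0 < R := hr.trans_le hR
  have hRr : 1 ≤ R / r := (one_le_div hr).2 hR
  set ρ := n ^ (-p) with hρ
  set G := p * n ^ (-p - 1) with hG
  have hρp : 0 < ρ := by positivity
  have hGp : 0 < G := by positivity
  have e₀ : (2 * n) ^ (-p) = c₀ * ρ := Real.mul_rpow (by norm_num) hn0.le
  have e₁ : p * (2 * n) ^ (-p - 1) = c₁ * G := by
    rw [Real.mul_rpow (by norm_num) hn0.le]
    ring
  set F : ℝ × ℝ → Euc 3 := fun q => spiralPt p s q.1 q.2 with hF
  set Q : Set (ℝ × ℝ) := {q | q.1 ∈ Icc n (n + 1) ∧ q.2 ∈ Icc 0 Real.pi ∧ F q ∈ ball x R} with hQ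
  have hE : ball x R ∩ spiralBlock p s n = F '' Q := by
    ext y
    constructor
    · rintro ⟨hy, u, hu, v, hv, rfl⟩
      exact ⟨(u, v), ⟨hu, hv, hy⟩, rfl⟩
    · rintro ⟨⟨u, v⟩, ⟨hu, hv, hy⟩, rfl⟩
      exact ⟨hy, u, hu, v, hv, rfl⟩
  have hdist : ∀ q ∈ Q, ∀ q' ∈ Q, dist (F q) (F q') ≤ 2 * R := by
    intro q hq q' hq'
    have h1 := mem_ball.1 hq.2.2
    have h2 := mem_ball.1 hq'.2.2
    have := dist_triangle_right (F q) (F q') x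
    linarith
  have hsin0 : ∀ q ∈ Q, 0 ≤ Real.sin q.2 := fun q hq =>
    Real.sin_nonneg_of_nonneg_of_le_pi hq.2.1.1 hq.2.1.2
  rw [hE]
  have key := meshCubeCount_image_le_of_slices (r := r) (L := K₁ * (R / r))
    (B := (2 * (K₂ * (R / r)) + 3) * 729) (by positivity) (by positivity) F
    (fun q => q.2 * ρ / r) Q ?_ ?_
  · refine key.trans ?_
    have h1 : 2 * (K₁ * (R / r)) + 3 ≤ (2 * K₁ + 3) * (R / r) := by nlinarith
    have h2 : 2 * (K₂ * (R / r)) + 3 ≤ (2 * K₂ + 3) * (R / r) := by nlinarith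
    calc _ ≤ ((2 * K₁ + 3) * (R / r)) * (((2 * K₂ + 3) * (R / r)) * 729) := by gcongr
      _ = _ := by ring
  · intro q hq q' hq'
    have h1 := (spiralPt_dist_lower hp hs hn hq.1 hq'.1 hq.2.1 hq'.2.1).2.1.trans
      (hdist q hq q' hq')
    rw [e₀] at h1
    rw [← sub_div, ← sub_mul, abs_div, abs_mul, abs_of_pos hr, abs_of_pos hρp, ← mul_div_assoc]
    refine div_le_div_of_nonneg_right ?_ hr.le
    rw [hK₁, div_mul_eq_mul_div, le_div_iff₀ hc₀p]
    rw [mul_div_assoc', div_mul_eq_mul_div, div_le_iff₀ (by positivity)] at h1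
    linarith
  · intro Q' hQ' hv
    rcases Q'.eq_empty_or_nonempty with rfl | ⟨b, hb⟩
    · have : meshCubes 3 r (F '' ∅) = ∅ := by simp [meshCubes]
      rw [meshCubeCount_eq, this]
      simp only [Set.ncard_empty, Nat.cast_zero]
      positivity
    have hv1 : ∀ q ∈ Q', ∀ q' ∈ Q', ρ * |q.2 - q'.2| ≤ r := by
      intro q hq q' hq'
      have h := hv q hq q' hq'
      rw [← sub_div, ← sub_mul, abs_div, abs_mul, abs_of_pos hr, abs_of_pos hρp,
        div_le_one hr] at h
      linarith
    have hsin : ∀ q ∈ Q', ∀ q' ∈ Q', ρ * Real.sin q.2 ≤ ρ * Real.sin q'.2 + r := by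
      intro q hq q' hq'
      have h2 : Real.sin q.2 - Real.sin q'.2 ≤ |q.2 - q'.2| :=
        (le_abs_self _).trans (Real.abs_sin_sub_sin_le _ _)
      nlinarith [hv1 q hq q' hq', mul_le_mul_of_nonneg_left h2 hρp.le]
    have hu1 : ∀ q ∈ Q', ∀ q' ∈ Q', |q.1 - q'.1| ≤ 1 := by
      intro q hq q' hq'
      have h1 := (hQ' hq).1
      have h2 := (hQ' hq').1
      exact abs_le.2 ⟨by linarith [h1.1, h2.2], by linarith [h1.2, h2.1]⟩
    set l := ρ * Real.sin b.2 + G with hl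
    have hsb := hsin0 b (hQ' hb)
    have hlp : 0 < l := by positivity
    refine meshCubeCount_image_le_of_slices (by positivity) (by norm_num) F
      (fun q => q.1 * l / r) Q' ?_ ?_
    · intro q hq q' hq'
      have h2R := hdist q (hQ' hq) q' (hQ' hq')
      obtain ⟨h1, -, h3⟩ := spiralPt_dist_lower hp hs hn (hQ' hq).1 (hQ' hq').1 (hQ' hq).2.1
        (hQ' hq').2.1
      have h1 := h1.trans h2R
      have h3 := h3.trans h2R
      rw [e₁] at h1
      rw [e₀] at h3
      rw [← sub_div, ← sub_mul, abs_div, abs_mul, abs_of_pos hr, abs_of_pos hlp, ← mul_div_assoc]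
      refine div_le_div_of_nonneg_right ?_ hr.le
      set t := |q.1 - q'.1| with ht
      set m := min (Real.sin q.2) (Real.sin q'.2) with hm
      have ht0 : 0 ≤ t := abs_nonneg _
      have ht1 : t ≤ 1 := hu1 q hq q' hq'
      have hbm : ρ * Real.sin b.2 ≤ ρ * m + r := by
        rcases min_choice (Real.sin q.2) (Real.sin q'.2) with h | h
        · rw [hm, h]
          exact hsin b hb q hq
        · rw [hm, h]
          exact hsin b hb q' hq'
      have h4 : G * t ≤ 2 / c₁ * R := by
        rw [div_mul_eq_mul_div, le_div_iff₀ hc₁p]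
        linarith
      have h5 : ρ * m * t ≤ K₁ * R := by
        rw [hK₁, div_mul_eq_mul_div, le_div_iff₀ hc₀p]
        rw [mul_div_assoc', div_mul_eq_mul_div, div_mul_eq_mul_div,
          div_le_iff₀ (by positivity)] at h3
        linarith
      have h6 := mul_le_mul_of_nonneg_right hbm ht0
      have h7 : r * t ≤ R := by nlinarith
      rw [hl, hK₂]
      linarith
    · intro Q'' hQ'' hu
      have h9 := (meshCubes_of_dist_le hr 3 (E := F '' Q'') ?_).2
      · exact (Nat.cast_le.2 h9).trans (by norm_num)
      rintro _ ⟨q, hq, rfl⟩ _ ⟨q', hq', rfl⟩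
      have h := hu q hq q' hq'
      rw [← sub_div, ← sub_mul, abs_div, abs_mul, abs_of_pos hr, abs_of_pos hlp,
        div_le_one hr] at h
      have hq := hQ'' hq
      have hq' := hQ'' hq'
      have h1 := spiralPt_dist_sq_upper hp hs hn (hQ' hq).1 (hQ' hq').1 (hQ' hq).2.1
        (hQ' hq').2.1
      set t := |q.1 - q'.1| with ht
      set M := max (Real.sin q.2) (Real.sin q'.2) with hM
      have ht0 : 0 ≤ t := abs_nonneg _
      have ht1 : t ≤ 1 := hu1 q hq q' hq'
      have hM0 : 0 ≤ M := (hsin0 q (hQ' hq)).trans (le_max_left _ _)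
      have hMb : ρ * M ≤ ρ * Real.sin b.2 + r := by
        rcases max_choice (Real.sin q.2) (Real.sin q'.2) with h | h
        · rw [hM, h]
          exact hsin q hq b hb
        · rw [hM, h]
          exact hsin q' hq' b hb
      have hbt : 0 ≤ ρ * Real.sin b.2 * t := by positivity
      have hGt : 0 ≤ G * t := by positivity
      have h2 : G * t ≤ r := by rw [hl] at h; linarith
      have h3 : ρ * M * t ≤ 2 * r := by
        have := mul_le_mul_of_nonneg_right hMb ht0
        have : r * t ≤ r := by nlinarith
        rw [hl] at h
        linarith
      have g2 := pow_le_pow_left₀ hGt h2 2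
      have g3 := pow_le_pow_left₀ (by positivity) h3 2
      have g4 := pow_le_pow_left₀ (by positivity) (hv1 q hq q' hq') 2
      refine le_of_sq_le_sq ?_ (by positivity)
      have g5 := sq_nonneg r
      push_cast
      linarith [mul_pow 2 r 2, mul_pow 3 r 2]

lemma spiralBlock_subset_ball {p s n : ℝ} (hp : 0 < p) (hs : s ^ 2 = 1) (hn : 1 ≤ n) :
    spiralBlock p s n ⊆ ball 0 (2 * n ^ (-p)) := by
  rintro _ ⟨u, hu, v, -, rfl⟩
  have hn0 : 0 < n := by linarith
  have h0 : 0 < n ^ (-p) := by positivity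
  rw [mem_ball_zero_iff, norm_spiralPt hs (hn0.le.trans hu.1)]
  have := Real.rpow_le_rpow_of_nonpos hn0 hu.1 (neg_nonpos.2 hp.le)
  linarith

/-- The cubes met inside a ball of radius `R`: a full ball of radius `r ^ (p / (p + 1))` at the
centre, and boundedly many surface pieces for each turn outside of it. -/
lemma exists_meshCubeCount_ball_le {p : ℝ} (hp : 0 < p) :
    ∃ C : ℝ, 0 < C ∧ ∀ r R : ℝ, 0 < r → r < 1 → r ≤ R → ∀ x : Euc 3,
      (meshCubeCount 3 r (ball x R ∩ spiralShell p) : ℝ) ≤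
        C * (r ^ (-3 / (p + 1)) + ∑ n ∈ Finset.Icc 1 ⌊r ^ (-1 / (p + 1))⌋₊,
          min ((R / r) ^ 2) (((n : ℝ) ^ (-p) / r) ^ 2)) := by
  obtain ⟨C, hC, hblock⟩ := exists_meshCubeCount_block_le hp
  refine ⟨729 + 8 * C, by positivity, fun r R hr hr1 hR x => ?_⟩
  set t := r ^ (-1 / (p + 1)) with ht
  set E := ball x R ∩ spiralShell p with hE
  set N := Finset.Icc 1 ⌊t⌋₊ with hN
  have ht0 : 0 < t := by positivity
  have htp : t ^ (-p) / r = t := by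
    rw [ht, ← Real.rpow_mul hr.le, ← Real.rpow_sub_one hr.ne']
    congr 1
    field_simp
    ring
  have ht1 : 1 ≤ t :=
    Real.one_le_rpow_of_pos_of_le_one_of_nonpos hr hr1.le (div_nonpos_of_nonpos_of_nonneg
      (by norm_num) (by positivity))
  have hrt : r ≤ t ^ (-p) := by
    rw [div_eq_iff hr.ne'] at htp
    nlinarith
  have hcov : E ⊆ (E ∩ closedBall 0 (t ^ (-p))) ∪
      ((⋃ n ∈ N, E ∩ spiralBlock p 1 (n : ℕ)) ∪ ⋃ n ∈ N, E ∩ spiralBlock p (-1) (n : ℕ)) := by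
    intro y hy
    obtain ⟨s, u, v, hs, hu, hv, rfl⟩ := exists_spiralPt_of_mem hy.2
    rcases le_or_gt t u with h | h
    · refine Or.inl ⟨hy, ?_⟩
      rw [mem_closedBall_zero_iff, norm_spiralPt (by rcases hs with rfl | rfl <;> norm_num)
        (by linarith)]
      exact Real.rpow_le_rpow_of_nonpos ht0 h (by linarith)
    · have hmem : ⌊u⌋₊ ∈ N :=
        Finset.mem_Icc.2 ⟨(Nat.one_le_floor_iff u).2 hu, Nat.floor_le_floor h.le⟩
      have hu' : u ∈ Icc (⌊u⌋₊ : ℝ) (⌊u⌋₊ + 1) :=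
        ⟨Nat.floor_le (by linarith), (Nat.lt_floor_add_one u).le⟩
      right
      rcases hs with rfl | rfl
      · left
        simp only [Set.mem_iUnion]
        exact ⟨_, hmem, hy, u, hu', v, hv, rfl⟩
      · right
        simp only [Set.mem_iUnion]
        exact ⟨_, hmem, hy, u, hu', v, hv, rfl⟩
  have hsub : (E ∩ closedBall 0 (t ^ (-p))) ∪
      ((⋃ n ∈ N, E ∩ spiralBlock p 1 (n : ℕ)) ∪ ⋃ n ∈ N, E ∩ spiralBlock p (-1) (n : ℕ)) ⊆
      ball x R := by
    refine Set.union_subset (fun y hy => hy.1.1) (Set.union_subset ?_ ?_) <;>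
    exact Set.iUnion₂_subset fun n _ y hy => hy.1.1
  have hinner : (meshCubeCount 3 r (E ∩ closedBall 0 (t ^ (-p))) : ℝ) ≤
      729 * r ^ (-3 / (p + 1)) := by
    refine (meshCubeCount_le_volume hr hrt 0 Set.inter_subset_right).trans (le_of_eq ?_)
    rw [htp, ht, ← Real.rpow_natCast, ← Real.rpow_mul hr.le]
    congr 2
    push_cast
    ring
  have hone : ∀ s : ℝ, s ^ 2 = 1 → ∀ n ∈ N, (meshCubeCount 3 r (E ∩ spiralBlock p s n) : ℝ) ≤
      4 * C * min ((R / r) ^ 2) (((n : ℝ) ^ (-p) / r) ^ 2) := by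
    intro s hs n hn
    obtain ⟨hn1, hn2⟩ := Finset.mem_Icc.1 hn
    have hn1' : (1 : ℝ) ≤ n := by exact_mod_cast hn1
    have hn2' : (n : ℝ) ≤ t := (Nat.le_floor_iff ht0.le).1 hn2
    have hnr : r ≤ (n : ℝ) ^ (-p) :=
      hrt.trans (Real.rpow_le_rpow_of_nonpos (by linarith) hn2' (by linarith))
    rw [mul_min_of_nonneg _ _ (by positivity)]
    refine le_min ?_ ?_
    · have h1 : (meshCubeCount 3 r (E ∩ spiralBlock p s n) : ℝ) ≤
          meshCubeCount 3 r (ball x R ∩ spiralBlock p s n) := by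
        exact_mod_cast meshCubeCount_mono hr
          (Set.inter_subset_inter_left _ Set.inter_subset_left) x R Set.inter_subset_left
      have h2 := hblock s n r R hs hn1' hr hR x
      have h3 : 0 ≤ C * (R / r) ^ 2 := by positivity
      linarith
    · have h1 : (meshCubeCount 3 r (E ∩ spiralBlock p s n) : ℝ) ≤
          meshCubeCount 3 r (ball 0 (2 * (n : ℝ) ^ (-p)) ∩ spiralBlock p s n) := by
        exact_mod_cast meshCubeCount_mono hr
          (Set.subset_inter (Set.inter_subset_right.trans (spiralBlock_subset_ball hp hs hn1'))
            Set.inter_subset_right) 0 _ Set.inter_subset_left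
      have h2 := hblock s n r (2 * (n : ℝ) ^ (-p)) hs hn1' hr (by linarith) 0
      refine (h1.trans h2).trans (le_of_eq ?_)
      ring
  have hsum : ∀ s : ℝ, s ^ 2 = 1 →
      (meshCubeCount 3 r (⋃ n ∈ N, E ∩ spiralBlock p s (n : ℕ)) : ℝ) ≤
        4 * C * ∑ n ∈ N, min ((R / r) ^ 2) (((n : ℝ) ^ (-p) / r) ^ 2) := by
    intro s hs
    rw [Finset.mul_sum]
    refine le_trans ?_ (Finset.sum_le_sum (hone s hs))
    exact_mod_cast meshCubeCount_biUnion_le N fun n : ℕ => E ∩ spiralBlock p s n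
  have h1 := hsum 1 (by norm_num)
  have h2 := hsum (-1) (by norm_num)
  have hle := (meshCubeCount_mono hr hcov x R hsub).trans ((meshCubeCount_union_le _ _).trans
    (Nat.add_le_add_left (meshCubeCount_union_le _ _) _))
  have hle' := (Nat.cast_le (α := ℝ)).2 hle
  push_cast at hle'
  have hS : 0 ≤ ∑ n ∈ N, min ((R / r) ^ 2) (((n : ℝ) ^ (-p) / r) ^ 2) :=
    Finset.sum_nonneg fun n _ => by positivity
  have hr3 : 0 ≤ r ^ (-3 / (p + 1)) := by positivity
  nlinarith [mul_nonneg hC.le hr3]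

/-- A uniform counting bound bounds the `θ`-Assouad spectrum from above. -/
lemma assouadSpec_le {d : ℕ} {θ α C : ℝ} {E : Set (Euc d)} (hα : 0 < α) (hC : 0 < C)
    (h : ∀ r : ℝ, 0 < r → r < 1 → ∀ x ∈ E,
      (meshCubeCount d r (ball x (r ^ θ) ∩ E) : ℝ) ≤ C * r ^ (-((1 - θ) * α))) :
    assouadSpec d θ E ≤ α := by
  refine csInf_le ⟨0, fun a ha => ha.1.le⟩ ⟨hα, C, hC, fun r hr hr1 x hx => ?_⟩
  rw [← Real.rpow_mul hr.le, show (θ - 1) * α = -((1 - θ) * α) by ring]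
  exact h r hr hr1 x hx

lemma assouadSpec_le_three {θ : ℝ} (hθ : θ ∈ Ioo (0 : ℝ) 1) (E : Set (Euc 3)) :
    assouadSpec 3 θ E ≤ 3 := by
  refine assouadSpec_le (C := 729) (by norm_num) (by norm_num) fun r hr hr1 x _ => ?_
  have hR : r ≤ r ^ θ := by
    simpa using Real.rpow_le_rpow_of_exponent_ge hr hr1.le hθ.2.le
  refine (meshCubeCount_le_volume hr hR x
    (Set.inter_subset_left.trans ball_subset_closedBall)).trans (le_of_eq ?_)
  rw [← Real.rpow_sub_one hr.ne', ← Real.rpow_natCast, ← Real.rpow_mul hr.le]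
  congr 2
  push_cast
  ring

/-- Away from the critical exponent, `∑ n ^ (-2 * p)` over `n ≤ t` is controlled by a power of
`t`. -/
lemma sum_rpow_neg_two_mul_le {p ε t : ℝ} (ht : 0 < t) (T : Finset ℕ)
    (hT : ∀ n ∈ T, 1 ≤ n) (hcmp : ∀ n ∈ T, (n : ℝ) ^ (1 - 2 * p + ε) ≤ t ^ (1 - 2 * p + ε))
    (hε : 0 < ε) :
    ∑ n ∈ T, ((n : ℝ) ^ (-p)) ^ 2 ≤
      t ^ (1 - 2 * p + ε) * (1 + ∑' n : ℕ, (n : ℝ) ^ (-1 - ε)) := by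
  have hsum : Summable fun n : ℕ => (n : ℝ) ^ (-1 - ε) := Real.summable_nat_rpow.2 (by linarith)
  calc ∑ n ∈ T, ((n : ℝ) ^ (-p)) ^ 2
      ≤ ∑ n ∈ T, t ^ (1 - 2 * p + ε) * (n : ℝ) ^ (-1 - ε) := by
        refine Finset.sum_le_sum fun n hn => ?_
        have hn0 : (0 : ℝ) < n := by exact_mod_cast hT n hn
        have : ((n : ℝ) ^ (-p)) ^ 2 = (n : ℝ) ^ (1 - 2 * p + ε) * (n : ℝ) ^ (-1 - ε) := by
          rw [← Real.rpow_natCast, ← Real.rpow_mul hn0.le, ← Real.rpow_add hn0]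
          congr 1
          push_cast
          ring
        rw [this]
        exact mul_le_mul_of_nonneg_right (hcmp n hn) (by positivity)
    _ = t ^ (1 - 2 * p + ε) * ∑ n ∈ T, (n : ℝ) ^ (-1 - ε) := by rw [Finset.mul_sum]
    _ ≤ _ := by
        gcongr
        have := hsum.sum_le_tsum T fun n _ => Real.rpow_nonneg n.cast_nonneg _
        linarith

lemma assouadSpec_spiralShell_le_of_le_half {p θ : ℝ} (hp : 0 < p) (hp2 : p ≤ 1 / 2)
    (hθ : θ ∈ Ioo (0 : ℝ) 1) :
    assouadSpec 3 θ (spiralShell p) ≤ 3 / ((1 + p) * (1 - θ)) := by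
  have hθ1 : 0 < 1 - θ := by linarith [hθ.2]
  refine le_of_forall_gt_imp_ge_of_dense fun α hα => ?_
  have hα0 : 0 < α := lt_trans (by positivity) hα
  rw [div_lt_iff₀ (by positivity)] at hα
  set ε := (1 - θ) * α * (p + 1) - 3 with hε
  have hε0 : 0 < ε := by rw [hε]; linarith
  obtain ⟨C, hC, h⟩ := exists_meshCubeCount_ball_le hp
  set K := 1 + ∑' n : ℕ, (n : ℝ) ^ (-1 - ε) with hK
  have hK0 : 0 < K := by
    have : 0 ≤ ∑' n : ℕ, (n : ℝ) ^ (-1 - ε) :=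
      tsum_nonneg fun n => Real.rpow_nonneg n.cast_nonneg _
    linarith
  refine assouadSpec_le hα0 (C := C * (1 + K)) (by positivity) fun r hr hr1 x _ => ?_
  have hR : r ≤ r ^ θ := by
    simpa using Real.rpow_le_rpow_of_exponent_ge hr hr1.le hθ.2.le
  refine (h r _ hr hr1 hR x).trans ?_
  rw [mul_assoc]
  refine mul_le_mul_of_nonneg_left ?_ hC.le
  have e : -((1 - θ) * α) = (-3 - ε) / (p + 1) := by
    rw [hε]
    field_simp
    ring
  rw [e]
  have h1 : r ^ (-3 / (p + 1)) ≤ r ^ ((-3 - ε) / (p + 1)) :=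
    Real.rpow_le_rpow_of_exponent_ge hr hr1.le (by gcongr; linarith)
  set t := r ^ (-1 / (p + 1)) with ht
  have ht0 : 0 < t := by positivity
  have h2 := sum_rpow_neg_two_mul_le (p := p) ht0 (Finset.Icc 1 ⌊t⌋₊)
    (fun n hn => (Finset.mem_Icc.1 hn).1) (fun n hn => by
      have hn2 : (n : ℝ) ≤ t := (Nat.le_floor_iff ht0.le).1 (Finset.mem_Icc.1 hn).2
      have : 0 ≤ 1 - 2 * p + ε := by linarith
      gcongr) hε0
  have h3 : ∑ n ∈ Finset.Icc 1 ⌊t⌋₊, min ((r ^ θ / r) ^ 2) (((n : ℝ) ^ (-p) / r) ^ 2) ≤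
      K * r ^ ((-3 - ε) / (p + 1)) := by
    calc _ ≤ ∑ n ∈ Finset.Icc 1 ⌊t⌋₊, r ^ (-2 : ℝ) * ((n : ℝ) ^ (-p)) ^ 2 := by
          refine Finset.sum_le_sum fun n _ => (min_le_right _ _).trans (le_of_eq ?_)
          rw [Real.rpow_neg hr.le, Real.rpow_two]
          field_simp
      _ ≤ r ^ (-2 : ℝ) * (t ^ (1 - 2 * p + ε) * K) := by
          rw [← Finset.mul_sum]
          gcongr
      _ = K * (r ^ (-2 : ℝ) * t ^ (1 - 2 * p + ε)) := by ring
      _ = _ := by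
          rw [ht, ← Real.rpow_mul hr.le, ← Real.rpow_add hr]
          congr 2
          field_simp
          ring
  linarith

lemma assouadSpec_spiralShell_le_of_half_lt {p θ : ℝ} (hp2 : 1 / 2 < p)
    (hθ : θ ∈ Ioo (0 : ℝ) 1) (hθp : θ ≤ p / (p + 1)) :
    assouadSpec 3 θ (spiralShell p) ≤ 2 + θ / (p * (1 - θ)) := by
  have hp : 0 < p := by linarith
  have hθ0 := hθ.1
  have hθ1 : 0 < 1 - θ := by linarith [hθ.2]
  refine le_of_forall_gt_imp_ge_of_dense fun α hα => ?_
  have hα0 : 0 < α := lt_trans (by positivity) hα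
  set β := θ / p with hβ
  have hβ0 : 0 < β := by positivity
  have hβp : β * p = θ := by rw [hβ]; field_simp
  have hβ1 : β ≤ 1 / (p + 1) := by
    rw [hβ, div_le_iff₀ hp]
    rw [div_mul_eq_mul_div, one_mul]
    exact hθp
  have hα' : 2 * (1 - θ) + β < (1 - θ) * α := by
    have h1 := mul_lt_mul_of_pos_right hα hθ1
    have h2 : (2 + θ / (p * (1 - θ))) * (1 - θ) = 2 * (1 - θ) + β := by
      rw [hβ]
      field_simp
    linarith
  obtain ⟨ε, hε0, hε1, hε2⟩ : ∃ ε : ℝ, 0 < ε ∧ ε ≤ 2 * p - 1 ∧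
      β * (1 - 2 * p + ε) + 2 ≤ (1 - θ) * α := by
    refine ⟨min (2 * p - 1) (((1 - θ) * α - 2 * (1 - θ) - β) / β), lt_min (by linarith)
      (div_pos (by linarith) hβ0), min_le_left _ _, ?_⟩
    have h1 := mul_le_mul_of_nonneg_left
      (min_le_right (2 * p - 1) (((1 - θ) * α - 2 * (1 - θ) - β) / β)) hβ0.le
    rw [mul_div_cancel₀ _ hβ0.ne'] at h1
    linarith
  obtain ⟨C, hC, h⟩ := exists_meshCubeCount_ball_le hp
  set K := 1 + ∑' n : ℕ, (n : ℝ) ^ (-1 - ε) with hK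
  have hK0 : 0 < K := by
    have : 0 ≤ ∑' n : ℕ, (n : ℝ) ^ (-1 - ε) :=
      tsum_nonneg fun n => Real.rpow_nonneg n.cast_nonneg _
    linarith
  refine assouadSpec_le hα0 (C := C * (2 + K)) (by positivity) fun r hr hr1 x _ => ?_
  have hR : r ≤ r ^ θ := by
    simpa using Real.rpow_le_rpow_of_exponent_ge hr hr1.le hθ.2.le
  refine (h r _ hr hr1 hR x).trans ?_
  rw [mul_assoc]
  refine mul_le_mul_of_nonneg_left ?_ hC.le
  set D := r ^ (-((1 - θ) * α)) with hD
  have h1 : r ^ (-3 / (p + 1)) ≤ D := by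
    refine Real.rpow_le_rpow_of_exponent_ge hr hr1.le ?_
    have : -3 / (p + 1) = -2 + (2 * p - 1) * (1 / (p + 1)) := by
      field_simp
      ring
    nlinarith
  set t := r ^ (-β) with ht
  have ht0 : 0 < t := by positivity
  set N := Finset.Icc 1 ⌊r ^ (-1 / (p + 1))⌋₊ with hN
  have hnear : ∑ n ∈ N with (n : ℕ) ≤ t,
      min ((r ^ θ / r) ^ 2) (((n : ℝ) ^ (-p) / r) ^ 2) ≤ D := by
    have hcard : ((N.filter fun n : ℕ => (n : ℝ) ≤ t).card : ℝ) ≤ t := by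
      have hsub : (N.filter fun n : ℕ => (n : ℝ) ≤ t) ⊆ Finset.Icc 1 ⌊t⌋₊ := by
        intro n hn
        rw [Finset.mem_filter, hN, Finset.mem_Icc] at hn
        exact Finset.mem_Icc.2 ⟨hn.1.1, Nat.le_floor hn.2⟩
      have := Finset.card_le_card hsub
      rw [Nat.card_Icc, Nat.add_sub_cancel] at this
      exact (Nat.cast_le.2 this).trans (Nat.floor_le ht0.le)
    calc _ ≤ ∑ n ∈ N with (n : ℕ) ≤ t, (r ^ θ / r) ^ 2 :=
          Finset.sum_le_sum fun n _ => min_le_left _ _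
      _ = (N.filter fun n : ℕ => (n : ℝ) ≤ t).card * (r ^ θ / r) ^ 2 := by simp
      _ ≤ t * (r ^ θ / r) ^ 2 := by gcongr
      _ = r ^ (-β + (θ - 1) * (2 : ℕ)) := by
          rw [← Real.rpow_sub_one hr.ne', ← Real.rpow_natCast, ← Real.rpow_mul hr.le,
            ← Real.rpow_add hr]
      _ ≤ D := by
          refine Real.rpow_le_rpow_of_exponent_ge hr hr1.le ?_
          push_cast
          linarith
  have hfar : ∑ n ∈ N with ¬ (n : ℕ) ≤ t,
      min ((r ^ θ / r) ^ 2) (((n : ℝ) ^ (-p) / r) ^ 2) ≤ K * D := by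
    have h2 := sum_rpow_neg_two_mul_le (p := p) ht0 (N.filter fun n : ℕ => ¬ (n : ℝ) ≤ t)
      (fun n hn => (Finset.mem_Icc.1 (Finset.mem_filter.1 hn).1).1) (fun n hn =>
        Real.rpow_le_rpow_of_nonpos ht0 (not_le.1 (Finset.mem_filter.1 hn).2).le
          (by linarith)) hε0
    calc _ ≤ ∑ n ∈ N with ¬ (n : ℕ) ≤ t, r ^ (-2 : ℝ) * ((n : ℝ) ^ (-p)) ^ 2 := by
          refine Finset.sum_le_sum fun n _ => (min_le_right _ _).trans (le_of_eq ?_)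
          rw [Real.rpow_neg hr.le, Real.rpow_two]
          field_simp
      _ ≤ r ^ (-2 : ℝ) * (t ^ (1 - 2 * p + ε) * K) := by
          rw [← Finset.mul_sum]
          gcongr
      _ = K * (r ^ (-2 : ℝ) * t ^ (1 - 2 * p + ε)) := by ring
      _ ≤ K * D := by
          gcongr
          rw [ht, ← Real.rpow_mul hr.le, ← Real.rpow_add hr]
          exact Real.rpow_le_rpow_of_exponent_ge hr hr1.le (by linarith)
  rw [← Finset.sum_filter_add_sum_filter_not N (fun n : ℕ => (n : ℝ) ≤ t)]
  linarith

/-! ### Lower bounds -/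

set_option maxHeartbeats 1600000 in
/-- The turns `u ∈ [π * N, 2 * π * N + 1]` alone meet many cubes. -/
lemma exists_le_meshCubeCount {p : ℝ} (hp : 0 < p) :
    ∃ c : ℝ, 0 < c ∧ ∀ (N : ℕ) (r R : ℝ) (x : Euc 3) (E : Set (Euc 3)), 1 ≤ N → 0 < r →
      E ⊆ ball x R → (∀ y ∈ spiralShell p, ‖y‖ ≤ (N : ℝ) ^ (-p) → y ∈ E) →
      c * ((N : ℝ) ^ (1 - 2 * p) * r ^ (-2 : ℝ) / (1 + r * (N : ℝ) ^ (p + 1))) ≤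
        meshCubeCount 3 r E := by
  have hpi := Real.pi_gt_three
  have hpi' := Real.pi_lt_d2
  set c' : ℝ := 8 ^ (p + 1) / p + 1 with hc'
  have hc'0 : 0 < c' := by positivity
  refine ⟨1 / (1024 * (8 ^ p) ^ 2 * c'), by positivity, fun N r R x E hN hr hER hE => ?_⟩
  have hN1 : (1 : ℝ) ≤ N := by exact_mod_cast hN
  have hN0 : (0 : ℝ) < N := by linarith
  set Y : ℝ := (8 * N) ^ p with hY
  have hY0 : 0 < Y := by positivity
  have hYinv : (8 * N : ℝ) ^ (-p) = Y⁻¹ := Real.rpow_neg (by positivity) _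
  set δ : ℝ := 16 * Y * r with hδ
  have hδ0 : 0 < δ := by positivity
  set A : ℕ := ⌊1 / (2 * δ)⌋₊ + 1 with hA
  have hAlow : 1 / (2 * δ) ≤ A := by
    rw [hA]
    push_cast
    exact (Nat.lt_floor_add_one _).le
  have hAδ : ∀ i < A, (i : ℝ) * δ ≤ 1 / 2 := by
    intro i hi
    have h1 : (i : ℝ) ≤ 1 / (2 * δ) :=
      (Nat.le_floor_iff (by positivity)).1 (Nat.lt_succ_iff.1 hi)
    rw [le_div_iff₀ (by positivity)] at h1
    linarith
  set J : ℕ := ⌈r * (8 * N) ^ (p + 1) / p⌉₊ with hJ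
  have hJpos : 0 < J := Nat.ceil_pos.2 (by positivity)
  have hJ1 : (1 : ℝ) ≤ J := by exact_mod_cast hJpos
  have hJlow : r * (8 * N) ^ (p + 1) / p ≤ J := Nat.le_ceil _
  have hJup : (J : ℝ) ≤ c' * (1 + r * (N : ℝ) ^ (p + 1)) := by
    have h1 : (J : ℝ) < r * (8 * N) ^ (p + 1) / p + 1 := Nat.ceil_lt_add_one (by positivity)
    rw [Real.mul_rpow (by norm_num) hN0.le] at h1
    have h2 : c' * (1 + r * (N : ℝ) ^ (p + 1)) = r * (8 ^ (p + 1) * (N : ℝ) ^ (p + 1)) / p + 1 +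
        (8 ^ (p + 1) / p + r * (N : ℝ) ^ (p + 1)) := by
      rw [hc']
      ring
    have h3 : 0 ≤ 8 ^ (p + 1) / p + r * (N : ℝ) ^ (p + 1) := by positivity
    linarith
  set K : ℕ := N / J + 1 with hK
  have hKlow : (N : ℝ) / J ≤ K := by
    rw [div_le_iff₀ (by positivity)]
    have := Nat.lt_div_mul_add hJpos (a := N)
    have h2 : N ≤ K * J := by
      rw [hK]
      nlinarith
    exact_mod_cast h2
  have hKJ : ∀ k < K, (k : ℝ) * J ≤ N := by
    intro k hk
    have h2 : k * J ≤ N := (Nat.le_div_iff_mul_le hJpos).1 (Nat.lt_succ_iff.1 hk)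
    exact_mod_cast h2
  set T : Finset (ℕ × ℕ × ℕ) := Finset.range K ×ˢ Finset.range A ×ˢ Finset.range A with hT
  set U : ℕ × ℕ × ℕ → ℝ := fun q => Real.pi * (N + q.1 * J) + q.2.1 * δ with hU
  set V : ℕ × ℕ × ℕ → ℝ := fun q => 1 + q.2.2 * δ with hV
  have hUmem : ∀ q ∈ T, U q ∈ Icc (N : ℝ) (8 * N) := by
    intro q hq
    rw [hT, Finset.mem_product, Finset.mem_product, Finset.mem_range, Finset.mem_range] at hq
    have h1 := hKJ _ hq.1
    have h2 := hAδ _ hq.2.1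
    have h3 : 0 ≤ (q.1 : ℝ) * J := by positivity
    have h4 : 0 ≤ (q.2.1 : ℝ) * δ := by positivity
    constructor
    · simp only [hU]
      nlinarith
    · simp only [hU]
      nlinarith
  have hVmem : ∀ q ∈ T, V q ∈ Icc (1 : ℝ) (3 / 2) := by
    intro q hq
    rw [hT, Finset.mem_product, Finset.mem_product, Finset.mem_range, Finset.mem_range,
      Finset.mem_range] at hq
    have h2 := hAδ _ hq.2.2
    have h4 : 0 ≤ (q.2.2 : ℝ) * δ := by positivity
    constructor <;> simp only [hV] <;> linarith
  have hcard := card_le_meshCubeCount hr T (fun q => spiralPt p 1 (U q) (V q)) x R hER ?_ ?_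
  · have h1 : (K : ℝ) * (A * A) ≤ meshCubeCount 3 r E := by
      rw [hT, Finset.card_product, Finset.card_product, Finset.card_range, Finset.card_range]
        at hcard
      exact_mod_cast hcard
    refine le_trans ?_ h1
    calc _ = (N : ℝ) / (c' * (1 + r * (N : ℝ) ^ (p + 1))) * (1 / (2 * δ) * (1 / (2 * δ))) := by
          have e1 : (N : ℝ) ^ (1 - 2 * p) = N / ((N : ℝ) ^ p) ^ 2 := by
            rw [Real.rpow_sub hN0, Real.rpow_one, ← Real.rpow_natCast, ← Real.rpow_mul hN0.le]
            push_cast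
            rw [mul_comm p 2]
          rw [e1, Real.rpow_neg hr.le, Real.rpow_two, hδ, hY,
            Real.mul_rpow (by norm_num) hN0.le]
          field_simp
          norm_num
      _ ≤ (N : ℝ) / J * (A * A) := by gcongr
      _ ≤ _ := by gcongr
  · intro q hq
    have h1 := hUmem q hq
    refine hE _ (spiralPt_one_mem (hN1.trans h1.1) (hVmem q hq).1) ?_
    rw [norm_spiralPt (by norm_num) (by linarith [h1.1])]
    exact Real.rpow_le_rpow_of_nonpos hN0 h1.1 (by linarith)
  · intro q hq q' hq' hne
    have hu := hUmem q hq
    have hu' := hUmem q' hq'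
    have hv := hVmem q hq
    have hv' := hVmem q' hq'
    refine le_of_sq_le_sq ?_ dist_nonneg
    rw [dist_spiralPt_sq (by norm_num)]
    have hlow : ∀ w ∈ Icc (N : ℝ) (8 * N), Y⁻¹ ≤ w ^ (-p) := fun w hw => by
      rw [← hYinv]
      exact Real.rpow_le_rpow_of_nonpos (by linarith [hw.1]) hw.2 (by linarith)
    have ha := hlow _ hu
    have ha' := hlow _ hu'
    have hgap := (abs_rpow_neg_sub_mem hp hN0 hu hu').1
    set a := U q ^ (-p)
    set a' := U q' ^ (-p)
    have hYi0 : 0 < Y⁻¹ := by positivity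
    have hcc : Y⁻¹ ^ 2 ≤ a * a' := by nlinarith
    have haa : 0 ≤ a * a' := (sq_nonneg _).trans hcc
    have hsin : ∀ w ∈ Icc (1 : ℝ) (3 / 2), 3 / 5 ≤ Real.sin w := by
      intro w hw
      refine le_trans ?_ (Real.mul_le_sin (by linarith [hw.1]) (by linarith [hw.2]))
      rw [div_mul_eq_mul_div, le_div_iff₀ (by positivity)]
      nlinarith [hw.1]
    have hs := hsin _ hv
    have hs' := hsin _ hv'
    have hss : 9 / 25 ≤ Real.sin (V q) * Real.sin (V q') := by nlinarith
    have t1 : 0 ≤ a * a' * (4 * Real.sin ((V q - V q') / 2) ^ 2) := by positivity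
    have t2 : 0 ≤ a * a' *
        (4 * (Real.sin (V q) * Real.sin (V q')) * Real.sin ((U q - U q') / 2) ^ 2) := by
      have : 0 ≤ Real.sin (V q) * Real.sin (V q') := by linarith
      positivity
    have hnat : ∀ i j : ℕ, i ≠ j → 1 ≤ |(i : ℝ) - j| := by
      intro i j hij
      have h1 : (i : ℤ) - j ≠ 0 := sub_ne_zero.2 (by exact_mod_cast hij)
      exact_mod_cast Int.one_le_abs h1
    have hhalf : ∀ i j : ℕ, i < A → j < A → i ≠ j →
        δ ^ 2 / 10 ≤ Real.sin (((i : ℝ) * δ - j * δ) / 2) ^ 2 := by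
      intro i j hi hj hij
      have h1 := hAδ i hi
      have h2 := hAδ j hj
      have h3 : 0 ≤ (i : ℝ) * δ := by positivity
      have h4 : 0 ≤ (j : ℝ) * δ := by positivity
      have h5 := abs_div_pi_le_abs_sin_half (t := (i : ℝ) * δ - j * δ)
        (abs_le.2 ⟨by linarith, by linarith⟩)
      have h6 : δ ≤ |(i : ℝ) * δ - j * δ| := by
        rw [← sub_mul, abs_mul, abs_of_pos hδ0]
        nlinarith [hnat i j hij]
      have h7 : δ / Real.pi ≤ |Real.sin (((i : ℝ) * δ - j * δ) / 2)| :=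
        le_trans (by gcongr) h5
      have h8 := pow_le_pow_left₀ (by positivity) h7 2
      rw [sq_abs] at h8
      refine le_trans ?_ h8
      rw [div_pow]
      gcongr
      nlinarith
    have hYδ : Y⁻¹ ^ 2 * δ ^ 2 = 256 * r ^ 2 := by
      rw [hδ]
      field_simp
      norm_num
    rw [hT, Finset.mem_product, Finset.mem_product, Finset.mem_range, Finset.mem_range,
      Finset.mem_range] at hq hq'
    by_cases hk : q.1 = q'.1
    · by_cases hi : q.2.1 = q'.2.1
      · have hj : q.2.2 ≠ q'.2.2 := fun hj => hne (Prod.ext hk (Prod.ext hi hj))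
        have h1 := hhalf _ _ hq.2.2 hq'.2.2 hj
        rw [show (q.2.2 : ℝ) * δ - q'.2.2 * δ = V q - V q' by simp only [hV]; ring] at h1
        have h2 : Y⁻¹ ^ 2 * (4 * (δ ^ 2 / 10)) ≤
            a * a' * (4 * Real.sin ((V q - V q') / 2) ^ 2) := by gcongr
        nlinarith [sq_nonneg (a - a'), sq_nonneg r]
      · have h1 := hhalf _ _ hq.2.1 hq'.2.1 hi
        rw [show (q.2.1 : ℝ) * δ - q'.2.1 * δ = U q - U q' by simp only [hU, hk]; ring] at h1
        have h2 : Y⁻¹ ^ 2 * (4 * (9 / 25) * (δ ^ 2 / 10)) ≤ a * a' *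
            (4 * (Real.sin (V q) * Real.sin (V q')) * Real.sin ((U q - U q') / 2) ^ 2) := by
          gcongr
        nlinarith [sq_nonneg (a - a'), sq_nonneg r]
    · have h1 : 2 * (J : ℝ) ≤ |U q - U q'| := by
        have h2 := hAδ _ hq.2.1
        have h3 := hAδ _ hq'.2.1
        have h4 : 0 ≤ (q.2.1 : ℝ) * δ := by positivity
        have h5 : 0 ≤ (q'.2.1 : ℝ) * δ := by positivity
        have h6 : (J : ℝ) ≤ |((q.1 : ℝ) - q'.1) * J| := by
          rw [abs_mul, abs_of_pos (show (0 : ℝ) < J by positivity)]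
          nlinarith [hnat _ _ hk]
        have h7 : U q - U q' = Real.pi * (((q.1 : ℝ) - q'.1) * J) + (q.2.1 * δ - q'.2.1 * δ) := by
          simp only [hU]
          ring
        rw [h7]
        rcases le_abs.1 h6 with h | h
        · exact le_abs.2 (Or.inl (by nlinarith))
        · exact le_abs.2 (Or.inr (by nlinarith))
      have h2 : 2 * r ≤ |a - a'| := by
        refine le_trans ?_ hgap
        have h3 : (8 * N : ℝ) ^ (-p - 1) = ((8 * N : ℝ) ^ (p + 1))⁻¹ := by
          rw [← Real.rpow_neg (by positivity)]
          congr 1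
          ring
        rw [h3]
        rw [div_le_iff₀ hp] at hJlow
        have h4 : 2 * (r * (8 * N) ^ (p + 1)) ≤ p * |U q - U q'| := by nlinarith
        rw [mul_right_comm, ← div_eq_mul_inv, le_div_iff₀ (by positivity)]
        linarith
      have h3 := pow_le_pow_left₀ (by positivity) h2 2
      rw [sq_abs] at h3
      nlinarith

/-- A lower bound for the number of cubes met in balls of radius `r ^ θ` close to the centre,
using the turns `u ≈ r ^ (-β)`. -/
lemma exists_le_meshCubeCount_ball {p θ β : ℝ} (hp : 0 < p) (hβ0 : 0 < β) (hβ : θ ≤ β * p) :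
    ∃ c : ℝ, 0 < c ∧ ∀ r : ℝ, 0 < r → r < 1 → ∃ x ∈ spiralShell p,
      c * (r ^ (-(β * (1 - 2 * p)) - 2) / (1 + r ^ (1 - β * (p + 1)))) ≤
        meshCubeCount 3 r (ball x (r ^ θ) ∩ spiralShell p) := by
  obtain ⟨c, hc, h⟩ := exists_le_meshCubeCount hp
  set k : ℝ := 4 ^ (1 / p) with hk
  have hk1 : 1 ≤ k := Real.one_le_rpow (by norm_num) (by positivity)
  have hk0 : 0 < k := by linarith
  have hkp : k ^ (-p) = 1 / 4 := by
    rw [hk, ← Real.rpow_mul (by norm_num), show 1 / p * -p = -1 by field_simp, Real.rpow_neg_one]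
    norm_num
  set m : ℝ := min (k ^ (1 - 2 * p)) ((2 * k) ^ (1 - 2 * p)) with hm
  have hm0 : 0 < m := by positivity
  set M : ℝ := (2 * k) ^ (p + 1) with hM
  have hM1 : 1 ≤ M := Real.one_le_rpow (by linarith) (by linarith)
  refine ⟨c * m / M, by positivity, fun r hr hr1 => ?_⟩
  set t := r ^ (-β) with ht
  have ht1 : 1 ≤ t := Real.one_le_rpow_of_pos_of_le_one_of_nonpos hr hr1.le (by linarith)
  have ht0 : 0 < t := by linarith
  set N : ℕ := ⌈k * t⌉₊ with hN
  have hNlow : k * t ≤ N := Nat.le_ceil _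
  have hkt : 1 ≤ k * t := by nlinarith
  have hN1 : (1 : ℝ) ≤ N := hkt.trans hNlow
  have hNup : (N : ℝ) ≤ 2 * k * t := by
    have := Nat.ceil_lt_add_one (show 0 ≤ k * t by positivity)
    linarith
  have hNnat : 1 ≤ N := by exact_mod_cast hN1
  have hNp : (N : ℝ) ^ (-p) ≤ r ^ θ / 4 := by
    calc (N : ℝ) ^ (-p) ≤ (k * t) ^ (-p) :=
          Real.rpow_le_rpow_of_nonpos (by positivity) hNlow (by linarith)
      _ = r ^ (β * p) / 4 := by
          rw [Real.mul_rpow hk0.le ht0.le, hkp, ht, ← Real.rpow_mul hr.le, neg_mul_neg]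
          ring
      _ ≤ r ^ θ / 4 := by
          have := Real.rpow_le_rpow_of_exponent_ge hr hr1.le hβ
          linarith
  have hR0 : 0 < r ^ θ := by positivity
  refine ⟨spiralPt p 1 N 1, spiralPt_one_mem hN1 le_rfl, ?_⟩
  refine le_trans ?_ (h N r (r ^ θ) (spiralPt p 1 N 1) _ hNnat hr Set.inter_subset_left ?_)
  · have h1 : m * t ^ (1 - 2 * p) ≤ (N : ℝ) ^ (1 - 2 * p) := by
      rcases le_total 0 (1 - 2 * p) with hq | hq
      · calc m * t ^ (1 - 2 * p) ≤ k ^ (1 - 2 * p) * t ^ (1 - 2 * p) := by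
              gcongr
              exact min_le_left _ _
          _ = (k * t) ^ (1 - 2 * p) := (Real.mul_rpow hk0.le ht0.le).symm
          _ ≤ _ := by gcongr
      · calc m * t ^ (1 - 2 * p) ≤ (2 * k) ^ (1 - 2 * p) * t ^ (1 - 2 * p) := by
              gcongr
              exact min_le_right _ _
          _ = (2 * k * t) ^ (1 - 2 * p) := (Real.mul_rpow (by positivity) ht0.le).symm
          _ ≤ _ := Real.rpow_le_rpow_of_nonpos (by linarith) hNup hq
    have h2 : r * (N : ℝ) ^ (p + 1) ≤ M * r ^ (1 - β * (p + 1)) := by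
      calc r * (N : ℝ) ^ (p + 1) ≤ r * (2 * k * t) ^ (p + 1) := by gcongr
        _ = M * (r ^ (1 : ℝ) * t ^ (p + 1)) := by
            rw [Real.mul_rpow (by positivity) ht0.le, Real.rpow_one]
            ring
        _ = _ := by
            rw [ht, ← Real.rpow_mul hr.le, ← Real.rpow_add hr]
            congr 2
            ring
    have h3 : t ^ (1 - 2 * p) * r ^ (-2 : ℝ) = r ^ (-(β * (1 - 2 * p)) - 2) := by
      rw [ht, ← Real.rpow_mul hr.le, ← Real.rpow_add hr]
      congr 1
      ring
    rw [← h3]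
    have hX : 0 < r ^ (1 - β * (p + 1)) := by positivity
    calc _ = c * (m * t ^ (1 - 2 * p) * r ^ (-2 : ℝ) / (M * (1 + r ^ (1 - β * (p + 1))))) := by
          field_simp
      _ ≤ _ := by
          gcongr
          linarith
  · intro y hy hyn
    refine ⟨?_, hy⟩
    rw [mem_ball, dist_eq_norm]
    have h1 := norm_sub_le y (spiralPt p 1 N 1)
    rw [norm_spiralPt (by norm_num) (by positivity)] at h1
    linarith

/-- Counting at least `c * r ^ (-(1 - θ) * a)` cubes somewhere at every scale bounds the
`θ`-Assouad spectrum from below by `a`. -/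
lemma le_assouadSpec {θ a c : ℝ} (hθ : θ ∈ Ioo (0 : ℝ) 1) (hc : 0 < c) {E : Set (Euc 3)}
    (h : ∀ r : ℝ, 0 < r → r < 1 → ∃ x ∈ E,
      c * r ^ (-((1 - θ) * a)) ≤ meshCubeCount 3 r (ball x (r ^ θ) ∩ E)) :
    a ≤ assouadSpec 3 θ E := by
  have hθ1 : 0 < 1 - θ := by linarith [hθ.2]
  refine le_csInf ⟨3, by norm_num, 729, by norm_num, fun r hr hr1 x _ => ?_⟩ ?_
  · have hR : r ≤ r ^ θ := by
      simpa using Real.rpow_le_rpow_of_exponent_ge hr hr1.le hθ.2.le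
    refine (meshCubeCount_le_volume hr hR x
      (Set.inter_subset_left.trans ball_subset_closedBall)).trans (le_of_eq ?_)
    rw [← Real.rpow_sub_one hr.ne', ← Real.rpow_ofNat]
  rintro α ⟨-, C, hC, hα⟩
  by_contra! hlt
  have hpos : 0 < (1 - θ) * (a - α) := mul_pos hθ1 (by linarith)
  have hle : ∀ᶠ n : ℝ in 𝓝[>] 0, c ≤ C * n ^ ((1 - θ) * (a - α)) := by
    filter_upwards [Ioo_mem_nhdsGT (show (0 : ℝ) < 1 by norm_num)] with r hr
    obtain ⟨x, hx, hxc⟩ := h r hr.1 hr.2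
    have h1 := hxc.trans (hα r hr.1 hr.2 x hx)
    have hpow : 0 < r ^ ((1 - θ) * a) := Real.rpow_pos_of_pos hr.1 _
    have h2 := mul_le_mul_of_nonneg_right h1 hpow.le
    rw [mul_assoc, mul_assoc, ← Real.rpow_mul hr.1.le, ← Real.rpow_add hr.1,
      ← Real.rpow_add hr.1, neg_add_cancel, Real.rpow_zero, mul_one] at h2
    refine h2.trans (le_of_eq ?_)
    congr 2
    ring
  have hlim : Tendsto (fun n : ℝ => C * n ^ ((1 - θ) * (a - α))) (𝓝[>] 0) (𝓝 0) := by
    have h1 := (Real.continuousAt_rpow_const 0 ((1 - θ) * (a - α)) (Or.inr hpos.le)).tendsto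
    rw [Real.zero_rpow hpos.ne'] at h1
    simpa using (h1.mono_left nhdsWithin_le_nhds).const_mul C
  exact absurd (ge_of_tendsto hlim hle) (not_le.2 hc)

lemma three_le_assouadSpec_spiralShell {p θ : ℝ} (hp : 0 < p) (hθ : θ ∈ Ioo (0 : ℝ) 1)
    (hθp : p / (p + 1) ≤ θ) : 3 ≤ assouadSpec 3 θ (spiralShell p) := by
  have hβ : 0 < θ / p := div_pos hθ.1 hp
  obtain ⟨c, hc, h⟩ := exists_le_meshCubeCount_ball (θ := θ) hp hβ (by field_simp; rfl)
  refine le_assouadSpec hθ (c := c / 2) (by positivity) fun r hr hr1 => ?_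
  obtain ⟨x, hx, hxc⟩ := h r hr hr1
  refine ⟨x, hx, le_trans ?_ hxc⟩
  have hneg : 1 - θ / p * (p + 1) ≤ 0 := by
    rw [div_le_iff₀ (by positivity)] at hθp
    rw [sub_nonpos, div_mul_eq_mul_div, one_le_div hp]
    exact hθp
  have h1 : 1 ≤ r ^ (1 - θ / p * (p + 1)) :=
    Real.one_le_rpow_of_pos_of_le_one_of_nonpos hr hr1.le hneg
  calc c / 2 * r ^ (-((1 - θ) * 3))
      = c * (r ^ (-(θ / p * (1 - 2 * p)) - 2) / (2 * r ^ (1 - θ / p * (p + 1)))) := by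
        have : r ^ (-(θ / p * (1 - 2 * p)) - 2) =
            r ^ (-((1 - θ) * 3)) * r ^ (1 - θ / p * (p + 1)) := by
          rw [← Real.rpow_add hr]
          congr 1
          field_simp
          ring
        rw [this]
        field_simp
    _ ≤ _ := by
        gcongr
        linarith

/-- For `θ / p ≤ β ≤ 1 / (p + 1)` the surface pieces near the turns `u ≈ r ^ (-β)` are
separated at scale `r`. -/
lemma le_assouadSpec_spiralShell {p θ β a : ℝ} (hp : 0 < p) (hθ : θ ∈ Ioo (0 : ℝ) 1)
    (hβ0 : 0 < β) (hβ : θ ≤ β * p) (hβ1 : β * (p + 1) ≤ 1)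
    (ha : (1 - θ) * a = β * (1 - 2 * p) + 2) : a ≤ assouadSpec 3 θ (spiralShell p) := by
  obtain ⟨c, hc, h⟩ := exists_le_meshCubeCount_ball (θ := θ) hp hβ0 hβ
  refine le_assouadSpec hθ (c := c / 2) (by positivity) fun r hr hr1 => ?_
  obtain ⟨x, hx, hxc⟩ := h r hr hr1
  refine ⟨x, hx, le_trans ?_ hxc⟩
  have h1 : r ^ (1 - β * (p + 1)) ≤ 1 := Real.rpow_le_one hr.le hr1.le (by linarith)
  rw [ha, show -(β * (1 - 2 * p) + 2) = -(β * (1 - 2 * p)) - 2 by ring, div_mul_eq_mul_div,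
    mul_div_assoc]
  gcongr
  linarith

/-- **Theorem (Assouad spectrum of polynomial spiral shells).**
For `p > 0` and `θ ∈ (0,1)`: if `p ≤ 1/2` then `dim_A^θ 𝒮_p = min (3/((1+p)(1-θ))) 3`,
and if `p > 1/2` then `dim_A^θ 𝒮_p = min (2 + θ/(p(1-θ))) 3`. In particular
`dim_A^θ 𝒮_p = 3` for all `θ ∈ [p/(p+1), 1)`. -/
theorem assouadSpec_spiralShell (p : ℝ) (hp : 0 < p) :
    (∀ θ : ℝ, θ ∈ Ioo (0 : ℝ) 1 →
      (p ≤ 1 / 2 →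
        assouadSpec 3 θ (spiralShell p) = min (3 / ((1 + p) * (1 - θ))) 3) ∧
      (1 / 2 < p →
        assouadSpec 3 θ (spiralShell p) = min (2 + θ / (p * (1 - θ))) 3)) ∧
    (∀ θ : ℝ, p / (p + 1) ≤ θ → θ < 1 → assouadSpec 3 θ (spiralShell p) = 3) := by
  have hq : 0 < p / (p + 1) := by positivity
  have hthree : ∀ θ ∈ Ioo (0 : ℝ) 1, p / (p + 1) ≤ θ → assouadSpec 3 θ (spiralShell p) = 3 :=
    fun θ hθ hθp =>
      le_antisymm (assouadSpec_le_three hθ _) (three_le_assouadSpec_spiralShell hp hθ hθp)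
  refine ⟨fun θ hθ => ?_, fun θ hθp hθ1 => hthree θ ⟨hq.trans_le hθp, hθ1⟩ hθp⟩
  have hθ0 := hθ.1
  have hθ1 : 0 < 1 - θ := by linarith [hθ.2]
  rcases le_total (p / (p + 1)) θ with hθp | hθp
  · rw [hthree θ hθ hθp]
    rw [div_le_iff₀ (by positivity)] at hθp
    constructor
    · intro _
      rw [min_eq_right]
      rw [le_div_iff₀ (by positivity)]
      linarith
    · intro _
      rw [min_eq_right]
      have : 1 ≤ θ / (p * (1 - θ)) := by
        rw [one_le_div (by positivity)]
        linarith
      linarith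
  · constructor
    · intro hp2
      refine le_antisymm
        (le_min (assouadSpec_spiralShell_le_of_le_half hp hp2 hθ) (assouadSpec_le_three hθ _))
        ((min_le_left _ _).trans ?_)
      refine le_assouadSpec_spiralShell (β := 1 / (p + 1)) hp hθ (by positivity) ?_ ?_ ?_
      · rwa [div_mul_eq_mul_div, one_mul]
      · field_simp
        rfl
      · field_simp
        ring
    · intro hp2
      refine le_antisymm
        (le_min (assouadSpec_spiralShell_le_of_half_lt hp2 hθ hθp) (assouadSpec_le_three hθ _))
        ((min_le_left _ _).trans ?_)
      refine le_assouadSpec_spiralShell (β := θ / p) hp hθ (by positivity) ?_ ?_ ?_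
      · field_simp
        rfl
      · rw [le_div_iff₀ (by positivity)] at hθp
        rw [div_mul_eq_mul_div, div_le_one hp]
        exact hθp
      · field_simp
        ring
end
end
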